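/- arXiv:1211.3341 — 7 statements merged into one kernel-verified Lean document; each statement's English description precedes it below -/
import Mathlib

section
/- Let A be a measurable 3-sum-free subset of [0,1] with sup A = 1. Set a = inf A, A₁ = A ∩ [2/3, 1], ε₁ = inf A₁ − 2/3 and ε₂ = (1/3 − ε₁) − μ(A₁). Assume ε₁ + 2ε₂ ≤ 1/3 and a > 0. If μ(A ∩ [2/9 + a/3, 1]) = 1/3, then ε₁ = 0 and ε₂ = 0. -/
open MeasureTheory Set

noncomputable def NN (A : Set ℝ) (p q : ℝ) : ℝ := (volume (A ∩ Icc p q)).toReal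

lemma NN_fin (A : Set ℝ) (p q : ℝ) : volume (A ∩ Icc p q) ≠ ⊤ :=
  ne_top_of_le_ne_top (by simp) (measure_mono (μ := volume) (inter_subset_right : A ∩ Icc p q ⊆ Icc p q))

lemma NN_nonneg (A : Set ℝ) (p q : ℝ) : 0 ≤ NN A p q := ENNReal.toReal_nonneg

lemma NN_le (A : Set ℝ) {p q : ℝ} (h : p ≤ q) : NN A p q ≤ q - p := by
  have : volume (A ∩ Icc p q) ≤ volume (Icc p q) := measure_mono inter_subset_right
  rw [Real.volume_Icc] at this
  have h2 := ENNReal.toReal_mono (by simp) this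
  rwa [ENNReal.toReal_ofReal (by linarith)] at h2

lemma NN_zero (A : Set ℝ) {p q : ℝ} (h : q ≤ p) : NN A p q = 0 := by
  have : volume (A ∩ Icc p q) ≤ volume (Icc p q) := measure_mono inter_subset_right
  rw [Real.volume_Icc, ENNReal.ofReal_of_nonpos (by linarith)] at this
  simp [NN, le_antisymm this zero_le]

lemma NN_mono (A : Set ℝ) {p q p' q' : ℝ} (h : p' ≤ p) (h' : q ≤ q') : NN A p q ≤ NN A p' q' :=
  ENNReal.toReal_mono (NN_fin A p' q')
    (measure_mono (inter_subset_inter_right _ (Icc_subset_Icc h h')))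

lemma NN_sub (A : Set ℝ) (p q r : ℝ) : NN A p r ≤ NN A p q + NN A q r := by
  unfold NN
  rw [← ENNReal.toReal_add (NN_fin A p q) (NN_fin A q r)]
  apply ENNReal.toReal_mono (by simp [NN_fin])
  refine le_trans (measure_mono ?_) (measure_union_le _ _)
  rintro u ⟨hu, h1, h2⟩
  rcases le_total u q with h | h
  · exact Or.inl ⟨hu, h1, h⟩
  · exact Or.inr ⟨hu, h, h2⟩

lemma NN_split {A : Set ℝ} (hA : MeasurableSet A) {p q r : ℝ} (h : p ≤ q) (h' : q ≤ r) :
    NN A p q + NN A q r = NN A p r := by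
  refine le_antisymm ?_ (NN_sub A p q r)
  unfold NN
  rw [← ENNReal.toReal_add (NN_fin A p q) (NN_fin A q r)]
  apply ENNReal.toReal_mono (NN_fin A p r)
  have e : volume (A ∩ Icc p q) ≤ volume (A ∩ Ico p q) := by
    have : A ∩ Icc p q ⊆ (A ∩ Ico p q) ∪ {q} := by
      rintro u ⟨hu, h1, h2⟩
      rcases h2.lt_or_eq with h | h
      · exact Or.inl ⟨hu, h1, h⟩
      · exact Or.inr h
    refine (measure_mono this).trans ((measure_union_le _ _).trans ?_)
    simp
  refine (add_le_add_left e _).trans ?_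
  rw [← measure_union _ (hA.inter measurableSet_Icc)]
  · apply measure_mono
    rintro u (⟨hu, h1, h2⟩ | ⟨hu, h1, h2⟩)
    · exact ⟨hu, h1, by linarith⟩
    · exact ⟨hu, by linarith, h2⟩
  · rw [Set.disjoint_left]
    rintro u ⟨_, h1, h2⟩ ⟨_, h3, h4⟩
    linarith

def SF (A : Set ℝ) : Prop := ∀ x ∈ A, ∀ y ∈ A, ∀ z ∈ A, x + y ≠ 3 * z

lemma vol_aff (S : Set ℝ) (x : ℝ) : volume {u : ℝ | 3 * u - x ∈ S} = ENNReal.ofReal (1/3) * volume S := by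
  have : {u : ℝ | 3 * u - x ∈ S} = (fun u => 3 * u) ⁻¹' ((fun v => v + (-x)) ⁻¹' S) := by
    ext u; simp [sub_eq_add_neg]
  rw [this, Real.volume_preimage_mul_left (by norm_num), measure_preimage_add_right]
  norm_num [abs_of_pos]

lemma key0 {A : Set ℝ} (hA : MeasurableSet A) (hsf : SF A) {x : ℝ} (hx : x ∈ A) {p q : ℝ}
    (h : p ≤ q) : 3 * NN A p q + NN A (3*p-x) (3*q-x) ≤ 3 * (q - p) := by
  have hB := vol_aff (A ∩ Icc (3*p-x) (3*q-x)) x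
  set B := {u : ℝ | 3 * u - x ∈ A ∩ Icc (3*p-x) (3*q-x)} with hBdef
  have hd : Disjoint B (A ∩ Icc p q) := by
    rw [Set.disjoint_left]
    rintro u ⟨h1, _⟩ ⟨h2, _⟩
    exact hsf _ h1 x hx u h2 (by ring)
  have hu := measure_union (μ := volume) hd (hA.inter measurableSet_Icc)
  have hle : volume (B ∪ (A ∩ Icc p q)) ≤ volume (Icc p q) := by
    apply measure_mono
    rintro u (⟨_, h1, h2⟩ | ⟨_, h1⟩)
    · constructor <;> linarith
    · exact h1
  rw [hu, hB, Real.volume_Icc] at hle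
  have h2 := ENNReal.toReal_mono (by simp) hle
  rw [ENNReal.toReal_ofReal (by linarith), ENNReal.toReal_add
    (ENNReal.mul_ne_top (by simp) (NN_fin _ _ _)) (NN_fin _ _ _), ENNReal.toReal_mul,
    ENNReal.toReal_ofReal (by norm_num)] at h2
  unfold NN
  linarith

lemma key {A : Set ℝ} (hA : MeasurableSet A) (hsf : SF A) {x : ℝ} (hx : x ∈ closure A) {p q : ℝ}
    (h : p ≤ q) : 3 * NN A p q + NN A (3*p-x) (3*q-x) ≤ 3 * (q - p) := by
  apply le_of_forall_pos_le_add
  intro τ hτ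
  obtain ⟨y, hy, hxy⟩ := Metric.mem_closure_iff.1 hx (τ/2) (by linarith)
  rw [Real.dist_eq, abs_lt] at hxy
  have h0 := key0 hA hsf hy h
  have h1 := NN_sub A (3*p-x) (3*p-y) (3*q-x)
  have h2 := NN_sub A (3*p-y) (3*q-y) (3*q-x)
  have h3 : NN A (3*p-x) (3*p-y) ≤ τ/2 := by
    rcases le_total (3*p-x) (3*p-y) with h | h
    · linarith [NN_le A h]
    · linarith [NN_zero A h]
  have h4 : NN A (3*q-y) (3*q-x) ≤ τ/2 := by
    rcases le_total (3*q-y) (3*q-x) with h | h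
    · linarith [NN_le A h]
    · linarith [NN_zero A h]
  linarith

lemma refl0 {A : Set ℝ} (hA : MeasurableSet A) (hsf : SF A) {z : ℝ} (hz : z ∈ A) {p q : ℝ}
    (hpq : p + q = 3 * z) (h : p ≤ q) : 2 * NN A p q ≤ q - p := by
  set B := {u : ℝ | p + q - u ∈ A ∩ Icc p q} with hBdef
  have hB : volume B = volume (A ∩ Icc p q) := by
    have : B = (fun u => p + q - u) ⁻¹' (A ∩ Icc p q) := rfl
    rw [this, (Measure.measurePreserving_sub_left volume (p+q)).measure_preimage
      (hA.inter measurableSet_Icc).nullMeasurableSet]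
  have hd : Disjoint B (A ∩ Icc p q) := by
    rw [Set.disjoint_left]
    rintro u ⟨h1, _⟩ ⟨h2, _⟩
    exact hsf _ h1 u h2 z hz (by linarith)
  have hu := measure_union (μ := volume) hd (hA.inter measurableSet_Icc)
  have hle : volume (B ∪ (A ∩ Icc p q)) ≤ volume (Icc p q) := by
    apply measure_mono
    rintro u (⟨_, h1, h2⟩ | ⟨_, h1⟩)
    · constructor <;> linarith
    · exact h1
  rw [hu, hB, Real.volume_Icc] at hle
  have h2 := ENNReal.toReal_mono (by simp) hle
  rw [ENNReal.toReal_ofReal (by linarith), ENNReal.toReal_add (NN_fin _ _ _) (NN_fin _ _ _)] at h2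
  unfold NN
  linarith

lemma trim {A : Set ℝ} {p q : ℝ} (h : (A ∩ Icc p q).Nonempty) :
    ∃ e z, e ∈ closure A ∧ z ∈ closure A ∧ p ≤ e ∧ e ≤ z ∧ z ≤ q ∧ NN A p q = NN A e z := by
  have hb : BddBelow (A ∩ Icc p q) := ⟨p, fun u hu => hu.2.1⟩
  have ha : BddAbove (A ∩ Icc p q) := ⟨q, fun u hu => hu.2.2⟩
  refine ⟨sInf (A ∩ Icc p q), sSup (A ∩ Icc p q),
    closure_mono inter_subset_left (csInf_mem_closure h hb),
    closure_mono inter_subset_left (csSup_mem_closure h ha),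
    le_csInf h fun u hu => hu.2.1, csInf_le_csSup h hb ha, csSup_le h fun u hu => hu.2.2, ?_⟩
  unfold NN
  congr 2
  ext u
  constructor
  · intro hu; exact ⟨hu.1, csInf_le hb hu, le_csSup ha hu⟩
  · intro hu
    refine ⟨hu.1, le_trans (le_csInf h fun u hu => hu.2.1) hu.2.1,
      le_trans hu.2.2 (csSup_le h fun u hu => hu.2.2)⟩

lemma nonempty_of_pos {A : Set ℝ} {p q : ℝ} (h : 0 < NN A p q) : (A ∩ Icc p q).Nonempty := by
  rw [Set.nonempty_iff_ne_empty]
  intro h0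
  simp [NN, h0] at h

lemma Pnull {A : Set ℝ} (hA : MeasurableSet A) (b : ℝ) :
    volume {w : ℝ | b ≤ w ∧ NN A b w = (w - b) / 2} = 0 := by
  set f : ℝ → ℝ := fun t => A.indicator (fun _ => (1:ℝ)) t - 1/2 with hf
  have hfi1 : LocallyIntegrable (A.indicator (fun _ => (1:ℝ))) volume :=
    (locallyIntegrable_const (1:ℝ)).indicator hA
  have hfi : LocallyIntegrable f volume := hfi1.sub (locallyIntegrable_const _)
  have hG : ∀ w, b ≤ w → ∫ t in b..w, f t = NN A b w - (w-b)/2 := by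
    intro w hw
    rw [intervalIntegral.integral_sub]
    · rw [intervalIntegral.integral_of_le hw, ← integral_Icc_eq_integral_Ioc,
        setIntegral_indicator hA]
      simp [NN, measureReal_def, inter_comm]
      ring
    · exact (hfi1.integrableOn_isCompact isCompact_uIcc).intervalIntegrable
    · simp
  have hd := LocallyIntegrable.ae_hasDerivAt_integral hfi
  rw [ae_iff] at hd
  set T := {w : ℝ | (b < w ∧ NN A b w = (w - b) / 2) ∧
    HasDerivAt (fun x => ∫ (t : ℝ) in b..x, f t) (f w) w} with hT
  have hTn : volume T = 0 := by
    apply measure_null_of_locally_null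
    rintro w ⟨⟨h1, h2⟩, h3⟩
    refine ⟨{w}, ?_, by simp⟩
    have hne : f w ≠ 0 := by
      simp only [hf, Set.indicator]
      split_ifs <;> norm_num
    have := h3.eventually_ne (c := 0) hne
    rw [eventually_nhdsWithin_iff] at this
    rw [mem_nhdsWithin_iff_eventually]
    filter_upwards [this] with v hv hvT
    by_contra hvw
    apply hv hvw
    rw [hG v hvT.1.1.le, hvT.1.2]
    ring
  refine measure_mono_null (t := T ∪ {w | ¬ ∀ c, HasDerivAt (fun x => ∫ (t : ℝ) in c..x, f t) (f w) w} ∪ {b}) ?_ ?_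
  · rintro w ⟨h1, h2⟩
    rcases h1.eq_or_lt with h | h
    · right; exact h.symm
    · left
      by_cases h3 : ∀ c, HasDerivAt (fun x => ∫ (t : ℝ) in c..x, f t) (f w) w
      · left; exact ⟨⟨h, h2⟩, h3 b⟩
      · right; exact h3
  · exact measure_union_null (measure_union_null hTn hd) (by simp)

lemma vol_aff' (S : Set ℝ) (x : ℝ) : volume {w : ℝ | (w + x) / 3 ∈ S} = 3 * volume S := by
  have : {w : ℝ | (w + x) / 3 ∈ S} = (fun v => v + x) ⁻¹' ((fun u => (1/3) * u) ⁻¹' S) := by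
    ext u; simp [div_eq_inv_mul]
  rw [this, measure_preimage_add_right, Real.volume_preimage_mul_left (by norm_num)]
  norm_num [abs_of_pos]

lemma Psmall {A : Set ℝ} (hA : MeasurableSet A) (b ε : ℝ) (hε : 0 < ε) :
    ∃ τ > 0, (volume {w : ℝ | (b ≤ w ∧ w ≤ 1) ∧ |NN A b w - (w - b) / 2| ≤ τ}).toReal < ε := by
  set P : ℕ → Set ℝ := fun n => {w : ℝ | (b ≤ w ∧ w ≤ 1) ∧ |NN A b w - (w - b) / 2| ≤ 1 / ((n:ℝ)+1)}
    with hP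
  have hm : Measurable (fun w => NN A b w) :=
    Monotone.measurable (fun x y h => NN_mono A le_rfl h)
  have hfin : ∀ n, volume (P n) ≠ ⊤ := fun n =>
    ne_top_of_le_ne_top (by simp : volume (Icc b 1) ≠ ⊤) (measure_mono fun w hw => hw.1)
  have ht := tendsto_measure_iInter_atTop (μ := volume) (s := P) (fun n => by
      apply MeasurableSet.nullMeasurableSet
      have h1 : Measurable (fun w => NN A b w - (w - b) / 2) := by fun_prop
      have h2 : Measurable (fun w => |NN A b w - (w - b) / 2|) := continuous_abs.measurable.comp h1
      exact (measurableSet_Icc (a := b) (b := (1:ℝ))).inter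
        (measurableSet_le h2 (measurable_const (a := 1 / ((n:ℝ)+1)))))
    (by
      intro m n hmn w hw
      refine ⟨hw.1, hw.2.trans ?_⟩
      have : (m:ℝ) ≤ n := by exact_mod_cast hmn
      gcongr) ⟨0, hfin 0⟩
  have h0 : volume (⋂ n, P n) = 0 := by
    refine measure_mono_null ?_ (Pnull hA b)
    intro w hw
    rw [mem_iInter] at hw
    refine ⟨(hw 0).1.1, ?_⟩
    have : |NN A b w - (w - b) / 2| ≤ 0 := by
      apply le_of_forall_pos_le_add
      intro τ hτ
      obtain ⟨n, hn⟩ := exists_nat_one_div_lt hτ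
      linarith [(hw n).2]
    have := abs_eq_zero.1 (le_antisymm this (abs_nonneg _))
    linarith
  rw [h0] at ht
  obtain ⟨n, hn⟩ := (ht.eventually (gt_mem_nhds (ENNReal.ofReal_pos.2 hε))).exists
  refine ⟨1/((n:ℝ)+1), by positivity, ?_⟩
  have := (ENNReal.toReal_lt_toReal (hfin n) (by simp)).2 hn
  rwa [ENNReal.toReal_ofReal hε.le] at this

lemma Clem {A : Set ℝ} (hA : MeasurableSet A) (hsf : SF A) {b : ℝ} (hb1 : b ≤ 1)
    (hx : ∀ τ > 0, ∃ x ∈ A, b ≤ x ∧ x < b + τ) (hy : ∀ τ > 0, ∃ y ∈ A, 1 - τ < y ∧ y ≤ 1)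
    (hhalf : 1 - b ≤ 2 * NN A b 1) :
    3 * NN A (2*b/3) (2/3) + NN A b 1 ≤ 1 - b := by
  apply le_of_forall_pos_le_add
  intro ε hε
  obtain ⟨τ0, hτ0, hP⟩ := Psmall hA b (ε/3) (by linarith)
  obtain ⟨τ, hτ, hττ, hτε⟩ : ∃ τ > 0, τ ≤ τ0 ∧ τ ≤ ε/3 :=
    ⟨min τ0 (ε/3), by positivity, min_le_left _ _, min_le_right _ _⟩
  obtain ⟨x, hxA, hx1, hx2⟩ := hx τ hτ
  obtain ⟨y, hyA, hy1, hy2⟩ := hy τ hτ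
  have hv1 := vol_aff' (A ∩ Icc (2*b/3) ((b+1)/3)) x
  have hv2 := vol_aff' (A ∩ Icc ((b+1)/3) (2/3)) y
  set P := {w : ℝ | (b ≤ w ∧ w ≤ 1) ∧ |NN A b w - (w - b) / 2| ≤ τ0} with hPd
  set S1 := {w : ℝ | (w + x) / 3 ∈ A ∩ Icc (2*b/3) ((b+1)/3)} with hS1
  set S2 := {w : ℝ | (w + y) / 3 ∈ A ∩ Icc ((b+1)/3) (2/3)} with hS2
  have hPf : volume P ≠ ⊤ :=
    ne_top_of_le_ne_top (by simp : volume (Icc b 1) ≠ ⊤) (measure_mono fun w hw => hw.1)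
  have hm2 : MeasurableSet S2 := by
    have : Measurable (fun w : ℝ => (w + y) / 3) := by fun_prop
    exact this (hA.inter measurableSet_Icc)
  have hint : S1 ∩ S2 ⊆ P := by
    rintro w ⟨⟨h1, h2, h3⟩, ⟨h4, h5, h6⟩⟩
    have hwb : b ≤ w := by linarith
    have hw1 : w ≤ 1 := by linarith
    refine ⟨⟨hwb, hw1⟩, ?_⟩
    have r1 := refl0 hA hsf h1 (p := b) (q := w + x - b) (by ring) (by linarith)
    have r2 := refl0 hA hsf h4 (p := w + y - 1) (q := 1) (by ring) (by linarith)
    have r3 := NN_mono A (le_refl b) (by linarith : w ≤ w + x - b)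
    have r4 := NN_mono A (by linarith : w + y - 1 ≤ w) (le_refl 1)
    have r5 := NN_split hA hwb hw1
    rw [abs_le]
    constructor <;> linarith
  have hd : Disjoint (S1 ∪ S2) (A ∩ Icc b 1) := by
    rw [Set.disjoint_left]
    rintro w (⟨h1, _⟩ | ⟨h1, _⟩) ⟨h2, _⟩
    · exact hsf w h2 x hxA _ h1 (by ring)
    · exact hsf w h2 y hyA _ h1 (by ring)
  have hsub : (S1 ∪ S2) ∪ (A ∩ Icc b 1) ⊆ Icc (b - τ) (1 + τ) := by
    rintro w ((⟨_, h1, h2⟩ | ⟨_, h1, h2⟩) | ⟨_, h1, h2⟩)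
    all_goals constructor <;> linarith
  have e1 := measure_union (μ := volume) hd (hA.inter measurableSet_Icc)
  have e2 := measure_mono (μ := volume) hsub
  rw [e1, Real.volume_Icc] at e2
  have e3 := measure_union_add_inter (μ := volume) S1 hm2
  have e4 := measure_mono (μ := volume) hint
  have e5 : volume S1 + volume S2 + volume (A ∩ Icc b 1)
      ≤ ENNReal.ofReal (1 + τ - (b - τ)) + volume P := by
    rw [← e3, add_right_comm]
    exact add_le_add e2 e4
  rw [hv1, hv2] at e5
  have t1 : 3 * volume (A ∩ Icc (2*b/3) ((b+1)/3)) ≠ ⊤ := ENNReal.mul_ne_top (by simp) (NN_fin _ _ _)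
  have t2 : 3 * volume (A ∩ Icc ((b+1)/3) (2/3)) ≠ ⊤ := ENNReal.mul_ne_top (by simp) (NN_fin _ _ _)
  have e6 := ENNReal.toReal_mono (by simp [hPf]) e5
  rw [ENNReal.toReal_add (by simp [t1, t2]) (NN_fin _ _ _), ENNReal.toReal_add t1 t2,
    ENNReal.toReal_add (by simp) hPf, ENNReal.toReal_ofReal (by linarith), ENNReal.toReal_mul,
    ENNReal.toReal_mul] at e6
  have e7 := NN_sub A (2*b/3) ((b+1)/3) (2/3)
  unfold NN at *
  simp only [ENNReal.toReal_ofNat] at e6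
  linarith

lemma caseZero {A : Set ℝ} (hA : MeasurableSet A) (hsf : SF A) {E₀ ε₂ : ℝ} (hE : 1/3 < E₀)
    (hE2 : E₀ ≤ 4/9) (hε : 0 < ε₂) (hN : NN A (2/3) 1 = 1/3 - ε₂)
    (hD : ε₂/3 ≤ NN A E₀ (4/9)) : False := by
  set T := {t : ℝ | E₀ ≤ t ∧ t ≤ 4/9 ∧ NN A E₀ t = 0} with hT
  have hTne : T.Nonempty := ⟨E₀, le_rfl, hE2, NN_zero A le_rfl⟩
  have hTb : BddAbove T := ⟨4/9, fun t ht => ht.2.1⟩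
  set e := sSup T with he
  have he1 : E₀ ≤ e := le_csSup hTb ⟨le_rfl, hE2, NN_zero A le_rfl⟩
  have he2 : e ≤ 4/9 := csSup_le hTne fun t ht => ht.2.1
  have he0 : NN A E₀ e = 0 := by
    apply le_antisymm _ (NN_nonneg _ _ _)
    apply le_of_forall_pos_le_add
    intro τ hτ
    obtain ⟨t, ht, hte⟩ := exists_lt_of_lt_csSup hTne (show e - τ < sSup T by linarith)
    have h1 := NN_sub A E₀ t e
    have h2 := NN_le A (le_csSup hTb ht)
    linarith [ht.2.2]
  have hpos0 : ∀ t, e < t → t ≤ 4/9 → 0 < NN A e t := by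
    intro t h1 h2
    have h3 := NN_sub A E₀ e t
    by_contra h
    have h4 : NN A E₀ t = 0 := le_antisymm (by linarith) (NN_nonneg _ _ _)
    have : t ≤ e := le_csSup hTb ⟨by linarith, h2, h4⟩
    linarith
  have hlt : e < 4/9 := by
    rcases he2.lt_or_eq with h | h
    · exact h
    · rw [h] at he0; linarith
  have hpos : ∀ t, e < t → 0 < NN A e t := by
    intro t h1
    refine lt_of_lt_of_le (hpos0 (min t (4/9)) (lt_min h1 hlt) (min_le_right _ _))
      (NN_mono A le_rfl (min_le_left _ _))
  have hp := hpos (3*e-2/3) (by linarith)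
  obtain ⟨x, x', hx, hx', hex, hxx, hxe⟩ : ∃ x x', x ∈ A ∧ x' ∈ A ∧ e ≤ x ∧ x < x' ∧ x' ≤ 3*e-2/3 := by
    have hns : ¬ (A ∩ Icc e (3*e-2/3)).Subsingleton := by
      intro h
      have := h.measure_zero volume
      simp [NN, this] at hp
    rw [Set.not_subsingleton_iff] at hns
    obtain ⟨x, hx, y, hy, hxy⟩ := hns
    rcases lt_or_gt_of_ne hxy with h | h
    · exact ⟨x, y, hx.1, hy.1, hx.2.1, h, hy.2.2⟩
    · exact ⟨y, x, hy.1, hx.1, hy.2.1, h, hx.2.2⟩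
  have k1 := key0 hA hsf hx (p := e) (q := (x+1)/3) (by linarith)
  have k2 := key0 hA hsf hx' (p := e) (q := e + (x'-x)/3) (by linarith)
  have k3 := hpos (e + (x'-x)/3) (by linarith)
  rw [show 3 * ((x+1)/3) - x = 1 by ring] at k1
  rw [show 3 * (e + (x'-x)/3) - x' = 3*e - x by ring] at k2
  have s1 := NN_sub A (2/3) (3*e-x') 1
  have s2 := NN_sub A (3*e-x') (3*e-x) 1
  have s3 := NN_le A (show (2/3:ℝ) ≤ 3*e-x' by linarith)
  have s4 := NN_sub A E₀ e (4/9)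
  have s5 := NN_mono A (le_refl e) (show (4/9:ℝ) ≤ (x+1)/3 by linarith)
  linarith

lemma NN_le' (A : Set ℝ) {p q r : ℝ} (h : q - p ≤ r) (hr : 0 ≤ r) : NN A p q ≤ r := by
  rcases le_total p q with h1 | h1
  · linarith [NN_le A h1]
  · linarith [NN_zero A h1]

lemma casePos {A : Set ℝ} (hA : MeasurableSet A) (hsf : SF A) {a δ ε₂ b : ℝ} (ha : 0 < a)
    (hb : b = 2/3 + δ) (hδ : 0 < δ) (hε : 0 ≤ ε₂) (hN : NN A b 1 = 1 - b - ε₂) (hb1 : b ≤ 1)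
    (h1A : (1:ℝ) ∈ closure A)
    (hFD : δ + ε₂/3 ≤ NN A (2/9+a/3) (2/9+a/3+δ/3) + NN A ((1+a)/3) (2*b/3)) : False := by
  have W : ∀ x ∈ closure A, NN A ((x+b)/3) ((x+1)/3) ≤ ε₂/3 := by
    intro x hx
    have := key hA hsf hx (p := (x+b)/3) (q := (x+1)/3) (by linarith)
    rw [show 3 * ((x+b)/3) - x = b by ring, show 3 * ((x+1)/3) - x = 1 by ring] at this
    linarith
  have hF := NN_le A (show 2/9+a/3 ≤ 2/9+a/3+δ/3 by linarith)
  have hF0 := NN_nonneg A (2/9+a/3) (2/9+a/3+δ/3)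
  set F := NN A (2/9+a/3) (2/9+a/3+δ/3) with hFdef
  obtain ⟨η, hη⟩ : ∃ η, η = δ/3 - F := ⟨_, rfl⟩
  obtain ⟨E, Z, hE, hZ, haE, hEZ, hZb, hD⟩ :=
    trim (nonempty_of_pos (show 0 < NN A ((1+a)/3) (2*b/3) by linarith))
  rw [hD] at hFD
  have hpt : NN A (max (b/2) (3*Z-1)) Z ≤ ε₂/3 := by
    by_cases hne : 0 < NN A (max (b/2) (3*Z-1)) Z
    · obtain ⟨d, z, hd, _, h1, _, h2, h3⟩ := trim (nonempty_of_pos hne)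
      rw [h3]
      have := le_max_left (b/2) (3*Z-1)
      have := le_max_right (b/2) (3*Z-1)
      exact (NN_mono A (by linarith) (by linarith)).trans (W d hd)
    · linarith
  have hp := NN_sub A E (max (b/2) (3*Z-1)) Z
  have hKp : max (b/2) (3*Z-1) = 3*Z-1 := by
    rcases max_choice (b/2) (3*Z-1) with h | h
    · exfalso
      rw [h] at hp hpt
      have := NN_le' A (p := E) (q := b/2) (r := δ/2) (by linarith) (by linarith)
      linarith
    · exact h
  rw [hKp] at hp hpt
  obtain ⟨r, hrK, hrZ, hm⟩ : ∃ r, r ≤ 3*Z-1 ∧ r ≤ Z ∧ 2*δ/3 + η ≤ NN A E r := by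
    rcases le_total (3*Z-1) Z with h | h
    · exact ⟨3*Z-1, le_rfl, h, by linarith⟩
    · exact ⟨Z, h, le_rfl, by linarith⟩
  obtain ⟨E', s, _, hs, hE'E, hE's, hsr, hm'⟩ := trim (nonempty_of_pos (show 0 < NN A E r by linarith))
  have hm2 : 2*δ/3 + η ≤ NN A E s := by
    have := NN_mono A hE'E (le_refl s)
    linarith
  have hEs : E ≤ s := by linarith
  have hsE := NN_le A hEs
  -- (1)
  have a1 := NN_sub A E ((s+b)/3) Z
  have a2 := NN_sub A ((s+b)/3) ((s+1)/3) Z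
  have a3 := W s hs
  have a4 := NN_le A (show (s+1)/3 ≤ Z by linarith)
  -- (2)
  have b1 := NN_sub A E ((E+b)/3) Z
  have b2 := NN_sub A ((E+b)/3) ((E+1)/3) Z
  have b3 := NN_sub A ((E+1)/3) ((s+1)/3) Z
  have b4 := W E hE
  have b5 := key hA hsf h1A (p := (E+1)/3) (q := (s+1)/3) (by linarith)
  rw [show 3 * ((E+1)/3) - 1 = E by ring, show 3 * ((s+1)/3) - 1 = s by ring] at b5
  have b6 : E ≤ (E+b)/3 := by
    by_contra h
    have := NN_zero A (show (E+b)/3 ≤ E by linarith)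
    linarith
  have b7 := NN_le A b6
  have hη2 : η ≤ δ/12 - 3*(E-1/3)/4 := by linarith
  -- (3)
  have c1 := key hA hsf hE (p := 2/9+a/3) (q := 2/9+a/3+δ/3) (by linarith)
  have c2 := NN_sub A E (3*(2/9+a/3)-E) ((s+b)/3)
  have c3 := NN_sub A (3*(2/9+a/3)-E) (3*(2/9+a/3+δ/3)-E) ((s+b)/3)
  rcases le_total (E-1/3) a with h | h
  · have c4 := NN_le' A (p := E) (q := 3*(2/9+a/3)-E) (r := E-1/3) (by linarith) (by linarith)
    have c5 := NN_zero A (show (s+b)/3 ≤ 3*(2/9+a/3+δ/3)-E by linarith)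
    linarith
  · have c4 := NN_zero A (show 3*(2/9+a/3)-E ≤ E by linarith)
    have c5 := NN_le' A (p := 3*(2/9+a/3+δ/3)-E) (q := (s+b)/3) (r := E-1/3) (by linarith) (by linarith)
    linarith

theorem second_central_lemma (A : Set ℝ)
    (hA : A ⊆ Icc (0 : ℝ) 1) (hmeas : MeasurableSet A) (hsup : sSup A = 1)
    (hsf : ∀ x ∈ A, ∀ y ∈ A, ∀ z ∈ A, x + y ≠ 3 * z)
    (a ε₁ ε₂ : ℝ) (ha : a = sInf A)
    (hε₁ : ε₁ = sInf (A ∩ Icc (2/3 : ℝ) 1) - 2/3)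
    (hε₂ : ε₂ = (1/3 - ε₁) - (volume (A ∩ Icc (2/3 : ℝ) 1)).toReal)
    (hcond : ε₁ + 2 * ε₂ ≤ 1/3) (hapos : a > 0)
    (heq : (volume (A ∩ Icc (2/9 + a/3 : ℝ) 1)).toReal = 1/3) :
    ε₁ = 0 ∧ ε₂ = 0 := by
  have hSF : SF A := hsf
  have hne : A.Nonempty := by
    rw [Set.nonempty_iff_ne_empty]
    rintro rfl
    simp at hsup
  have hbb : BddBelow A := ⟨0, fun u hu => (hA hu).1⟩
  have hba : BddAbove A := ⟨1, fun u hu => (hA hu).2⟩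
  have h1A : (1:ℝ) ∈ closure A := hsup ▸ csSup_mem_closure hne hba
  have haA : a ∈ closure A := ha ▸ csInf_mem_closure hne hbb
  have ha1 : a ≤ 1 := by
    obtain ⟨u, hu⟩ := hne
    rw [ha]; exact (csInf_le hbb hu).trans (hA hu).2
  have hy : ∀ τ > 0, ∃ y ∈ A, 1 - τ < y ∧ y ≤ 1 := by
    intro τ hτ
    obtain ⟨y, hy, h⟩ := exists_lt_of_lt_csSup hne (show 1 - τ < sSup A by linarith)
    exact ⟨y, hy, h, (hA hy).2⟩
  have hne1 : (A ∩ Icc (2/3 : ℝ) 1).Nonempty := by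
    obtain ⟨y, hy, h1, h2⟩ := hy (1/3) (by norm_num)
    exact ⟨y, hy, by linarith, h2⟩
  have hbb1 : BddBelow (A ∩ Icc (2/3 : ℝ) 1) := hbb.mono inter_subset_left
  obtain ⟨b, hb⟩ : ∃ b, b = sInf (A ∩ Icc (2/3 : ℝ) 1) := ⟨_, rfl⟩
  have hbδ : b = 2/3 + ε₁ := by linarith
  have hb23 : 2/3 ≤ b := hb ▸ le_csInf hne1 fun u hu => hu.2.1
  have hb1 : b ≤ 1 := by
    obtain ⟨u, hu⟩ := hne1
    rw [hb]; exact (csInf_le hbb1 hu).trans hu.2.2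
  have hx : ∀ τ > 0, ∃ x ∈ A, b ≤ x ∧ x < b + τ := by
    intro τ hτ
    obtain ⟨x, hx, h⟩ := exists_lt_of_csInf_lt hne1 (show sInf (A ∩ Icc (2/3 : ℝ) 1) < b + τ by linarith)
    exact ⟨x, hx.1, hb ▸ csInf_le hbb1 hx, h⟩
  have hNb : NN A b 1 = NN A (2/3) 1 := by
    unfold NN
    congr 2
    ext u
    constructor
    · intro h; exact ⟨h.1, by linarith [h.2.1], h.2.2⟩
    · intro h; exact ⟨h.1, hb ▸ csInf_le hbb1 h, h.2.2⟩
  change ε₂ = (1/3 - ε₁) - NN A (2/3) 1 at hε₂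
  change NN A (2/9 + a/3) 1 = 1/3 at heq
  have hNb1 := NN_le A hb1
  have hC := Clem hmeas hSF hb1 hx hy (by linarith)
  have hK := key hmeas hSF haA (p := (a+b)/3) (q := (a+1)/3) (by linarith)
  rw [show 3 * ((a+b)/3) - a = b by ring, show 3 * ((a+1)/3) - a = 1 by ring] at hK
  have t1 := NN_sub A (2/9+a/3) (2/3) 1
  have t2 := NN_sub A (2/9+a/3) (2/9+a/3+ε₁/3) (2/3)
  have t3 := NN_sub A (2/9+a/3+ε₁/3) ((1+a)/3) (2/3)
  have t4 := NN_sub A ((1+a)/3) (2*b/3) (2/3)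
  rw [show (a+b)/3 = 2/9+a/3+ε₁/3 by linarith, show (a+1)/3 = (1+a)/3 by ring] at hK
  have hFD : ε₁ + ε₂/3 ≤ NN A (2/9+a/3) (2/9+a/3+ε₁/3) + NN A ((1+a)/3) (2*b/3) := by linarith
  rcases (show 0 ≤ ε₁ by linarith).eq_or_lt with h0 | h0
  · refine ⟨h0.symm, ?_⟩
    by_contra hne2
    have hpos : 0 < ε₂ := lt_of_le_of_ne (by linarith) (Ne.symm hne2)
    have hz := NN_zero A (show 2/9+a/3+ε₁/3 ≤ 2/9+a/3 by linarith)
    rw [show 2*b/3 = 4/9 by linarith] at hFD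
    have hle : (1+a)/3 ≤ 4/9 := by
      by_contra h
      have := NN_zero A (show (4/9:ℝ) ≤ (1+a)/3 by linarith)
      linarith
    exact caseZero hmeas hSF (E₀ := (1+a)/3) (by linarith) hle hpos (by linarith) (by linarith)
  · exact (casePos hmeas hSF hapos hbδ h0 (by linarith) (by linarith) hb1 h1A hFD).elim
end

section
/- Let A be a measurable 3-sum-free subset of [0,1] with sup A = 1 and μ(A) ≥ 5/12. Then μ(A ∩ [(inf A)/3 + 2/9, 1]) ≤ 1/3. -/
open MeasureTheory Set

section
open scoped Pointwise

lemma freiman_disc (p : ℕ) (hp : p.Prime) (X Y : Finset ℤ) (hX0 : (0:ℤ) ∈ X) (hXp : (p:ℤ) ∈ X)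
    (hX : ∀ x ∈ X, 0 ≤ x ∧ x ≤ p) (hY : ∀ y ∈ Y, 0 ≤ y ∧ y ≤ p) (hYn : Y.Nonempty) :
    min p ((X.erase p).card + (Y.erase p).card - 1) + (Y.erase p).card ≤ (X + Y).card := by
  classical
  have : Fact p.Prime := ⟨hp⟩
  have hp0 : (0:ℤ) < p := by exact_mod_cast hp.pos
  rcases (Y.erase p).eq_empty_or_nonempty with h | hY1
  · rw [h]
    have := Finset.card_le_card_add_right (s := X) hYn
    have h2 := Finset.card_erase_le (s := X) (a := (p:ℤ))
    simp only [Finset.card_empty]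
    omega
  set X1 := X.erase (p:ℤ) with hX1
  set Y1 := Y.erase (p:ℤ) with hY1d
  have hX1n : X1.Nonempty := ⟨0, by rw [hX1, Finset.mem_erase]; exact ⟨by omega, hX0⟩⟩
  have bX : ∀ x ∈ X1, 0 ≤ x ∧ x < p := by
    intro x hx
    rw [hX1, Finset.mem_erase] at hx
    have := hX x hx.2
    omega
  have bY : ∀ x ∈ Y1, 0 ≤ x ∧ x < p := by
    intro x hx
    rw [hY1d, Finset.mem_erase] at hx
    have := hY x hx.2
    omega
  have inj : ∀ (S : Finset ℤ), (∀ x ∈ S, 0 ≤ x ∧ x < p) →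
      (S.image (fun z : ℤ => (z : ZMod p))).card = S.card := by
    intro S hS
    apply Finset.card_image_of_injOn
    intro a ha b hb hab
    have hab' : ((a : ℤ) : ZMod p) = (b : ZMod p) := hab
    rw [ZMod.intCast_eq_intCast_iff] at hab'
    have h1 := hS a ha
    have h2 := hS b hb
    have : a % p = b % p := hab'
    rwa [Int.emod_eq_of_lt h1.1 h1.2, Int.emod_eq_of_lt h2.1 h2.2] at this
  have cd := ZMod.cauchy_davenport hp (s := X1.image (fun z : ℤ => (z : ZMod p)))
    (t := Y1.image (fun z : ℤ => (z : ZMod p))) (hX1n.image _) (hY1.image _)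
  rw [inj X1 bX, inj Y1 bY] at cd
  set Y2 := Y1.image (fun y => y + (p:ℤ)) with hY2
  have cY2 : Y2.card = Y1.card := Finset.card_image_of_injective _ (add_left_injective _)
  have sY2 : Y2 ⊆ X + Y := by
    intro z hz
    rw [hY2, Finset.mem_image] at hz
    obtain ⟨y, hy, rfl⟩ := hz
    have h3 := Finset.add_mem_add hXp (Finset.mem_of_mem_erase hy)
    show y + (p:ℤ) ∈ X + Y
    rw [add_comm y (p:ℤ)]
    exact h3
  have key : X1.image (fun z : ℤ => (z : ZMod p)) + Y1.image (fun z : ℤ => (z : ZMod p)) ⊆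
      ((X + Y) \ Y2).image (fun z : ℤ => (z : ZMod p)) := by
    intro r hr
    rw [Finset.mem_add] at hr
    obtain ⟨a, ha, b, hb, rfl⟩ := hr
    rw [Finset.mem_image] at ha hb
    obtain ⟨x, hx, rfl⟩ := ha
    obtain ⟨y, hy, rfl⟩ := hb
    rw [Finset.mem_image]
    by_cases hm : x + y ∈ Y2
    · rw [hY2, Finset.mem_image] at hm
      obtain ⟨y', hy', e⟩ := hm
      refine ⟨y', ?_, ?_⟩
      · rw [Finset.mem_sdiff]
        refine ⟨?_, ?_⟩
        · have := Finset.add_mem_add hX0 (Finset.mem_of_mem_erase hy')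
          simpa using this
        · intro h
          rw [hY2, Finset.mem_image] at h
          obtain ⟨y'', hy'', e'⟩ := h
          have := bY y' hy'
          have := bY y'' hy''
          omega
      · have : ((y' + p : ℤ) : ZMod p) = ((x + y : ℤ) : ZMod p) := by rw [e]
        push_cast at this
        simpa using this
    · refine ⟨x + y, ?_, by push_cast; rfl⟩
      rw [Finset.mem_sdiff]
      exact ⟨Finset.add_mem_add (Finset.mem_of_mem_erase hx) (Finset.mem_of_mem_erase hy), hm⟩
  have c1 := (Finset.card_le_card key).trans Finset.card_image_le
  have c2 := Finset.card_sdiff_add_card_eq_card sY2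
  omega

open Classical in
noncomputable def cellIdx (p : ℕ) (w z0 : ℝ) (Z : Set ℝ) : Finset ℤ :=
  (Finset.Icc (0:ℤ) p).filter (fun k => ∃ z ∈ Z, z0 + k * w ≤ z ∧ z < z0 + (k + 1) * w)

lemma cellIdx_iff {p : ℕ} {w z0 : ℝ} {Z : Set ℝ} {k : ℤ} : k ∈ cellIdx p w z0 Z ↔
    (0 ≤ k ∧ k ≤ (p:ℤ)) ∧ ∃ z ∈ Z, z0 + k * w ≤ z ∧ z < z0 + (k + 1) * w := by
  classical
  unfold cellIdx
  rw [Finset.mem_filter, Finset.mem_Icc]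

lemma mem_cellIdx {p : ℕ} {w z0 : ℝ} {Z : Set ℝ} (hw : 0 < w) (hZ : Z ⊆ Icc z0 (z0 + p * w))
    {z : ℝ} (hz : z ∈ Z) : ∃ k ∈ cellIdx p w z0 Z, z0 + k * w ≤ z ∧ z < z0 + (k + 1) * w := by
  have h1 := hZ hz
  have hfl := Int.floor_le ((z - z0) / w)
  have hlt := Int.lt_floor_add_one ((z - z0) / w)
  rw [le_div_iff₀ hw] at hfl
  rw [div_lt_iff₀ hw] at hlt
  have hk : z0 + (⌊(z - z0) / w⌋ : ℝ) * w ≤ z ∧ z < z0 + ((⌊(z - z0) / w⌋ : ℝ) + 1) * w :=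
    ⟨by linarith, by linarith⟩
  refine ⟨⌊(z - z0) / w⌋, ?_, hk⟩
  rw [cellIdx_iff]
  refine ⟨⟨Int.floor_nonneg.2 (div_nonneg (by linarith [h1.1]) hw.le), ?_⟩, z, hz, hk⟩
  have : (z - z0) / w ≤ p := by rw [div_le_iff₀ hw]; linarith [h1.2]
  have h2 := (Int.floor_le ((z - z0) / w)).trans this
  exact_mod_cast h2

lemma cellIdx_cover {p : ℕ} {w z0 : ℝ} {Z : Set ℝ} (hw : 0 < w)
    (hZ : Z ⊆ Icc z0 (z0 + p * w)) :
    volume.real Z ≤ w * ((cellIdx p w z0 Z).erase p).card := by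
  have hsub : Z ⊆ (⋃ k ∈ (cellIdx p w z0 Z).erase (p:ℤ), Ico (z0 + (k:ℝ) * w) (z0 + ((k:ℝ) + 1) * w))
      ∪ {z0 + p * w} := by
    intro z hz
    obtain ⟨k, hk, h1, h2⟩ := mem_cellIdx hw hZ hz
    by_cases hkp : k = p
    · right
      have := (hZ hz).2
      subst hkp
      simp only [mem_singleton_iff]
      push_cast at h1
      linarith
    · left
      simp only [mem_iUnion]
      exact ⟨k, Finset.mem_erase.2 ⟨hkp, hk⟩, h1, h2⟩
  have hfin : volume ((⋃ k ∈ (cellIdx p w z0 Z).erase (p:ℤ), Ico (z0 + (k:ℝ) * w) (z0 + ((k:ℝ) + 1) * w))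
      ∪ {z0 + p * w}) ≠ ⊤ := by
    apply ne_of_lt
    apply measure_union_lt_top
    · exact (measure_biUnion_lt_top (Finset.finite_toSet _) (fun k _ => by simp))
    · simp
  calc volume.real Z ≤ _ := measureReal_mono hsub hfin
    _ ≤ _ := measureReal_union_le _ _
    _ ≤ (∑ k ∈ (cellIdx p w z0 Z).erase (p:ℤ), w) + 0 := by
      gcongr
      · refine (measureReal_biUnion_finset_le _ _).trans (Finset.sum_le_sum fun k _ => ?_)
        rw [Real.volume_real_Ico]
        apply max_le _ hw.le
        apply le_of_eq; ring
      · simp [Measure.real]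
    _ = _ := by simp [mul_comm]

lemma fr_step {X Y : Set ℝ} (hXc : IsCompact X) (hYc : IsCompact Y) {x0 x1 y0 : ℝ}
    (h0 : x0 ∈ X) (h1 : x1 ∈ X) (hX : X ⊆ Icc x0 x1) (hY : Y ⊆ Icc y0 (y0 + (x1 - x0)))
    (hYn : Y.Nonempty) (hD : 0 < x1 - x0) (p : ℕ) (hp : p.Prime) :
    volume.real Y + min (x1 - x0) (volume.real X + volume.real Y) - (x1 - x0) / p ≤
      volume.real (Metric.cthickening (2 * ((x1 - x0) / p)) (X + Y)) := by
  have hp0 : (0:ℝ) < p := by exact_mod_cast hp.pos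
  set w := (x1 - x0) / p with hw
  have hw0 : 0 < w := div_pos hD hp0
  have hpw : p * w = x1 - x0 := by rw [hw]; field_simp
  have hX' : X ⊆ Icc x0 (x0 + p * w) := by rw [hpw]; simpa using hX
  have hY' : Y ⊆ Icc y0 (y0 + p * w) := by rw [hpw]; exact hY
  have cX := cellIdx_cover hw0 hX'
  have cY := cellIdx_cover hw0 hY'
  set Xp := cellIdx p w x0 X with hXp
  set Yp := cellIdx p w y0 Y with hYp
  have m0 : (0:ℤ) ∈ Xp := by
    rw [hXp]
    rw [cellIdx_iff]
    exact ⟨⟨le_rfl, by positivity⟩, x0, h0, by simp, by simp [hw0]⟩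
  have mp : (p:ℤ) ∈ Xp := by
    rw [hXp]
    rw [cellIdx_iff]
    refine ⟨⟨by positivity, le_rfl⟩, x1, h1, ?_, ?_⟩
    · push_cast; linarith
    · push_cast; linarith
  have bnd : ∀ (z0 : ℝ) (Z : Set ℝ), ∀ x ∈ cellIdx p w z0 Z, 0 ≤ x ∧ x ≤ (p:ℤ) := by
    intro z0 Z x hx
    rw [cellIdx_iff] at hx
    exact hx.1
  have nY : Yp.Nonempty := by
    obtain ⟨y, hy⟩ := hYn
    obtain ⟨k, hk, -⟩ := mem_cellIdx hw0 hY' hy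
    exact ⟨k, hk⟩
  have fd := freiman_disc p hp Xp Yp m0 mp (bnd _ _) (bnd _ _) nY
  have hXpos : 1 ≤ (Xp.erase (p:ℤ)).card := Finset.card_pos.2
    ⟨0, Finset.mem_erase.2 ⟨by have := hp.pos; omega, m0⟩⟩
  set a := (Xp.erase (p:ℤ)).card
  set b := (Yp.erase (p:ℤ)).card
  have hsub : (⋃ k ∈ Xp + Yp, Ico (x0 + y0 + (k:ℝ) * w) (x0 + y0 + ((k:ℝ) + 1) * w)) ⊆
      Metric.cthickening (2 * w) (X + Y) := by
    intro t ht
    simp only [mem_iUnion] at ht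
    obtain ⟨k, hk, ht1, ht2⟩ := ht
    rw [Finset.mem_add] at hk
    obtain ⟨i, hi, j, hj, rfl⟩ := hk
    rw [hXp] at hi
    rw [hYp] at hj
    rw [cellIdx_iff] at hi hj
    obtain ⟨-, x, hx, hx1, hx2⟩ := hi
    obtain ⟨-, y, hy, hy1, hy2⟩ := hj
    push_cast at ht1 ht2
    refine Metric.mem_cthickening_of_dist_le t (x + y) _ _ (add_mem_add hx hy) ?_
    rw [Real.dist_eq, abs_le]
    constructor <;> nlinarith
  have hcomp : IsCompact (Metric.cthickening (2 * w) (X + Y)) := (hXc.add hYc).cthickening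
  have hmu : w * (Xp + Yp).card ≤ volume.real (Metric.cthickening (2 * w) (X + Y)) := by
    refine le_trans (le_of_eq ?_) (measureReal_mono hsub hcomp.measure_lt_top.ne)
    rw [measureReal_biUnion_finset (h := fun k _ => measure_Ico_lt_top.ne)]
    · have : ∀ k ∈ Xp + Yp, volume.real (Ico (x0 + y0 + (k:ℝ) * w) (x0 + y0 + ((k:ℝ) + 1) * w)) = w := by
        intro k _
        rw [Real.volume_real_Ico_of_le (by nlinarith)]
        ring
      rw [Finset.sum_congr rfl this]
      simp [mul_comm]
    · intro i _ j _ hij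
      have := pairwise_disjoint_Ico_add_zsmul (x0 + y0) w hij
      simpa [Function.onFun] using this
    · intro k _; exact measurableSet_Ico
  have fd' : min (p:ℝ) ((a:ℝ) + b - 1) + b ≤ ((Xp + Yp).card : ℝ) := by
    have h : ((min p (a + b - 1) + b : ℕ) : ℝ) ≤ ((Xp + Yp).card : ℝ) := by exact_mod_cast fd
    rw [Nat.cast_add, Nat.cast_min, Nat.cast_sub (by omega)] at h
    push_cast at h
    exact h
  refine le_trans ?_ hmu
  refine le_trans ?_ (mul_le_mul_of_nonneg_left fd' hw0.le)
  rcases le_total (p:ℝ) ((a:ℝ) + b - 1) with h | h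
  · rw [min_eq_left h]
    have := min_le_left (x1 - x0) (volume.real X + volume.real Y)
    nlinarith
  · rw [min_eq_right h]
    have := min_le_right (x1 - x0) (volume.real X + volume.real Y)
    nlinarith

lemma fr_compact {X Y : Set ℝ} (hXc : IsCompact X) (hYc : IsCompact Y) {x0 x1 y0 : ℝ}
    (h0 : x0 ∈ X) (h1 : x1 ∈ X) (hX : X ⊆ Icc x0 x1) (hY : Y ⊆ Icc y0 (y0 + (x1 - x0)))
    (hYn : Y.Nonempty) (hD : 0 < x1 - x0) :
    volume.real Y + min (x1 - x0) (volume.real X + volume.real Y) ≤ volume.real (X + Y) := by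
  have hc := hXc.add hYc
  have T := tendsto_measure_cthickening_of_isCompact (μ := volume) hc
  have T2 : Filter.Tendsto (fun r => volume.real (Metric.cthickening r (X + Y))) (nhds 0)
      (nhds (volume.real (X + Y))) :=
    (ENNReal.tendsto_toReal hc.measure_lt_top.ne).comp T
  have L : Filter.Tendsto (fun n : ℕ => (x1 - x0) / (n:ℝ)) Filter.atTop (nhds 0) :=
    tendsto_const_div_atTop_nhds_zero_nat _
  have L2 : Filter.Tendsto (fun n : ℕ => 2 * ((x1 - x0) / (n:ℝ))) Filter.atTop (nhds 0) := by
    simpa using L.const_mul 2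
  have T3 := (T2.comp L2).add L
  rw [add_zero] at T3
  refine ge_of_tendsto_of_frequently T3 ?_
  rw [Filter.frequently_atTop]
  intro n
  obtain ⟨p, hpn, hp⟩ := Nat.exists_infinite_primes n
  refine ⟨p, hpn, ?_⟩
  have := fr_step hXc hYc h0 h1 hX hY hYn hD p hp
  simp only [Function.comp]
  linarith

noncomputable def FA (A : Set ℝ) (x : ℝ) : ℝ := volume.real (A ∩ Iic x)

lemma FA_sub {A : Set ℝ} (hA : A ⊆ Icc (0 : ℝ) 1) (hm : MeasurableSet A) {x y : ℝ} (h : x ≤ y) :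
    volume.real (A ∩ Icc x y) = FA A y - FA A x := by
  have hfin : ∀ B : Set ℝ, volume (A ∩ B) ≠ ⊤ := fun B =>
    ((measure_mono (inter_subset_left.trans hA)).trans_lt measure_Icc_lt_top).ne
  have e1 : A ∩ Iic y = (A ∩ Iic x) ∪ (A ∩ Ioc x y) := by
    rw [← inter_union_distrib_left, Iic_union_Ioc_eq_Iic h]
  have e2 : FA A y = FA A x + volume.real (A ∩ Ioc x y) := by
    unfold FA
    rw [e1, measureReal_union _ (hm.inter measurableSet_Ioc) (hfin _) (hfin _)]
    rw [Set.disjoint_left]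
    rintro z ⟨-, h1⟩ ⟨-, h2⟩
    exact absurd h1 (not_le.2 h2.1)
  have e3 : volume.real (A ∩ Icc x y) = volume.real (A ∩ Ioc x y) := by
    apply measureReal_congr
    exact (ae_eq_refl A).inter Ioc_ae_eq_Icc.symm
  linarith

lemma FA_mono {A : Set ℝ} (hA : A ⊆ Icc (0 : ℝ) 1) (hm : MeasurableSet A) {x y : ℝ} (h : x ≤ y) :
    FA A x ≤ FA A y := by
  have := FA_sub hA hm h
  have h2 : 0 ≤ volume.real (A ∩ Icc x y) := measureReal_nonneg
  linarith

lemma FA_lip {A : Set ℝ} (hA : A ⊆ Icc (0 : ℝ) 1) (hm : MeasurableSet A) {x y : ℝ} (h : x ≤ y) :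
    FA A y ≤ FA A x + (y - x) := by
  have := FA_sub hA hm h
  have h2 : volume.real (A ∩ Icc x y) ≤ volume.real (Icc x y) :=
    measureReal_mono inter_subset_right measure_Icc_lt_top.ne
  rw [Real.volume_real_Icc_of_le h] at h2
  linarith

lemma FA_eq_of_empty {A : Set ℝ} (hA : A ⊆ Icc (0 : ℝ) 1) (hm : MeasurableSet A) {x y : ℝ}
    (h : x ≤ y) (he : A ∩ Ioo x y = ∅) : FA A y = FA A x := by
  have := FA_sub hA hm h
  have e3 : volume.real (A ∩ Icc x y) = volume.real (A ∩ Ioo x y) := by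
    apply measureReal_congr
    exact (ae_eq_refl A).inter Ioo_ae_eq_Icc.symm
  rw [he] at e3
  simp at e3
  linarith

/-- The part of `[l,r]` that misses `3A`. -/
lemma third_bound {A : Set ℝ} (hA : A ⊆ Icc (0 : ℝ) 1) (hm : MeasurableSet A) {l r : ℝ} (h : l ≤ r)
    {B N : Set ℝ} (hN : volume N = 0) (hB : B ⊆ N ∪ Icc l r) (hd : ∀ z ∈ A, 3 * z ∉ B) :
    volume.real B + 3 * (FA A (r / 3) - FA A (l / 3)) ≤ r - l := by
  rw [← FA_sub hA hm (by linarith)]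
  set T : Set ℝ := (fun u : ℝ => u * (1/3)) ⁻¹' (A ∩ Icc (l/3) (r/3)) with hT
  have mT : MeasurableSet T := (measurable_id.mul_const _) (hm.inter measurableSet_Icc)
  have vT : volume.real T = 3 * volume.real (A ∩ Icc (l/3) (r/3)) := by
    unfold Measure.real
    rw [hT, Real.volume_preimage_mul_right (by norm_num), ENNReal.toReal_mul, ENNReal.toReal_ofReal (by positivity)]
    norm_num
  have sT : T ⊆ Icc l r := by
    intro u hu
    obtain ⟨-, h1, h2⟩ := hu
    simp only at h1 h2
    constructor <;> linarith
  have hs : B ⊆ N ∪ (Icc l r \ T) := by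
    intro b hb
    rcases hB hb with h1 | h1
    · exact Or.inl h1
    · right
      refine ⟨h1, fun h2 => hd (b * (1/3)) h2.1 ?_⟩
      have : 3 * (b * (1/3)) = b := by ring
      rwa [this]
  have fin : volume (N ∪ (Icc l r \ T)) ≠ ⊤ :=
    (measure_union_lt_top (by rw [hN]; exact ENNReal.zero_lt_top)
      ((measure_mono sdiff_subset).trans_lt measure_Icc_lt_top)).ne
  have h1 := (measureReal_mono hs fin).trans (measureReal_union_le _ _)
  rw [measureReal_sdiff sT mT measure_Icc_lt_top.ne, Real.volume_real_Icc_of_le h, vT] at h1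
  have h2 : volume.real N = 0 := by simp [Measure.real, hN]
  linarith

lemma exists_cpt {X : Set ℝ} (hm : MeasurableSet X) (hf : volume X ≠ ⊤) {ε : ℝ} (hε : 0 < ε) :
    ∃ K ⊆ X, IsCompact K ∧ volume.real X ≤ volume.real K + ε := by
  obtain ⟨K, hK, hc, h⟩ := hm.exists_isCompact_lt_add hf (ε := ENNReal.ofReal ε) (by simpa using hε)
  refine ⟨K, hK, hc, ?_⟩
  have := ENNReal.toReal_mono (by simp [hc.measure_lt_top.ne]) h.le
  rw [ENNReal.toReal_add hc.measure_lt_top.ne (by simp), ENNReal.toReal_ofReal hε.le] at this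
  exact this

lemma eps_lim {P Q η : ℝ} (hη : 0 < η) (h : ∀ ε, 0 < ε → ε < η → P ≤ Q + 20 * ε) : P ≤ Q := by
  by_contra hc
  push Not at hc
  have h1 : 0 < min (η / 2) ((P - Q) / 40) := lt_min (by linarith) (by linarith)
  have h2 := h _ h1 (lt_of_le_of_lt (min_le_left _ _) (by linarith))
  have := min_le_right (η / 2) ((P - Q) / 40)
  linarith

lemma min_lip {a b a' b' e : ℝ} (h1 : a ≤ a' + e) (h2 : b ≤ b' + e) : min a b ≤ min a' b' + e := by
  rcases le_total a' b' with h | h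
  · rw [min_eq_left h]; exact (min_le_left _ _).trans h1
  · rw [min_eq_right h]; exact (min_le_right _ _).trans h2

lemma core {A : Set ℝ} (hA : A ⊆ Icc (0 : ℝ) 1) (hm : MeasurableSet A)
    (hsf : ∀ x ∈ A, ∀ y ∈ A, ∀ z ∈ A, x + y ≠ 3 * z) {X Y N : Set ℝ} (hXA : X ⊆ A) (hYA : Y ⊆ A)
    (mX : MeasurableSet X) (mY : MeasurableSet Y) {x0 x1 y0 l r : ℝ}
    (h0 : x0 ∈ X) (h1 : x1 ∈ X) (hX : X ⊆ Icc x0 x1) (hY : Y ⊆ Icc y0 (y0 + (x1 - x0)))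
    (hYn : Y.Nonempty) (hD : x0 < x1) (hN : volume N = 0) (hlr : l ≤ r)
    (hs : ∀ x ∈ X, ∀ y ∈ Y, x + y ∈ N ∪ Icc l r) :
    volume.real Y + min (x1 - x0) (volume.real X + volume.real Y)
      + 3 * (FA A (r / 3) - FA A (l / 3)) ≤ r - l := by
  have fA : volume A ≠ ⊤ := ((measure_mono hA).trans_lt measure_Icc_lt_top).ne
  have fX : volume X ≠ ⊤ := ((measure_mono hXA).trans_lt fA.lt_top).ne
  have fY : volume Y ≠ ⊤ := ((measure_mono hYA).trans_lt fA.lt_top).ne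
  refine eps_lim (η := 1) one_pos fun ε hε _ => ?_
  obtain ⟨K, hK, cK, vK⟩ := exists_cpt mX fX hε
  obtain ⟨L, hL, cL, vL⟩ := exists_cpt mY fY hε
  obtain ⟨y, hy⟩ := hYn
  have cK' : IsCompact (K ∪ {x0, x1}) := cK.union (Set.Finite.isCompact (by simp))
  have cL' : IsCompact (L ∪ {y}) := cL.union isCompact_singleton
  have sK : K ∪ {x0, x1} ⊆ X := by
    intro x hx
    simp only [mem_union, mem_insert_iff, mem_singleton_iff] at hx
    rcases hx with h | rfl | rfl
    · exact hK h
    · exact h0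
    · exact h1
  have sL : L ∪ {y} ⊆ Y := union_subset hL (by simpa using hy)
  have fr := fr_compact cK' cL' (x0 := x0) (x1 := x1) (y0 := y0) (by simp) (by simp)
    (sK.trans hX) (sL.trans hY) ⟨y, by simp⟩ (by linarith)
  have tb := third_bound hA hm hlr (B := (K ∪ {x0, x1}) + (L ∪ {y})) hN (by
    rintro b ⟨u, hu, v, hv, rfl⟩
    exact hs u (sK hu) v (sL hv)) (by
    rintro z hz ⟨u, hu, v, hv, huv⟩
    exact hsf u (hXA (sK hu)) v (hYA (sL hv)) z hz huv)
  have v1 : volume.real K ≤ volume.real (K ∪ {x0, x1}) :=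
    measureReal_mono subset_union_left cK'.measure_lt_top.ne
  have v2 : volume.real L ≤ volume.real (L ∪ {y}) :=
    measureReal_mono subset_union_left cL'.measure_lt_top.ne
  have := min_lip (a := x1 - x0) (b := volume.real X + volume.real Y) (a' := x1 - x0)
    (b' := volume.real (K ∪ {x0, x1}) + volume.real (L ∪ {y})) (e := 2 * ε) (by linarith) (by linarith)
  linarith

lemma window {A : Set ℝ} (hA : A ⊆ Icc (0 : ℝ) 1) (hm : MeasurableSet A)
    (hsf : ∀ x ∈ A, ∀ y ∈ A, ∀ z ∈ A, x + y ≠ 3 * z) {ρ i0 i1 : ℝ} (hρ : ρ ∈ closure A)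
    (hi : i0 ≤ i1) :
    FA A i1 - FA A i0 + 3 * (FA A ((ρ + i1) / 3) - FA A ((ρ + i0) / 3)) ≤ i1 - i0 := by
  refine eps_lim (η := 1) one_pos fun ε hε _ => ?_
  obtain ⟨b, hb, hd⟩ := Metric.mem_closure_iff.1 hρ ε hε
  rw [Real.dist_eq, abs_lt] at hd
  have tb := third_bound hA hm (l := b + i0) (r := b + i1) (by linarith) (N := ∅)
    (B := (fun u => u + b) '' (A ∩ Icc i0 i1)) (by simp) (by
    rintro _ ⟨u, hu, rfl⟩
    right
    exact ⟨by linarith [hu.2.1], by linarith [hu.2.2]⟩) (by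
    rintro z hz ⟨u, hu, huv⟩
    exact hsf u hu.1 b hb z hz huv)
  have : volume.real ((fun u => u + b) '' (A ∩ Icc i0 i1)) = volume.real (A ∩ Icc i0 i1) := by
    unfold Measure.real
    rw [Set.image_add_right, measure_preimage_add_right]
  rw [this, FA_sub hA hm hi] at tb
  have k1 : FA A ((ρ + i1) / 3) ≤ FA A ((b + i1) / 3) + ε := by
    rcases le_total ((ρ + i1) / 3) ((b + i1) / 3) with h | h
    · linarith [FA_mono hA hm h]
    · linarith [FA_lip hA hm h]
  have k2 : FA A ((b + i0) / 3) ≤ FA A ((ρ + i0) / 3) + ε := by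
    rcases le_total ((b + i0) / 3) ((ρ + i0) / 3) with h | h
    · linarith [FA_mono hA hm h]
    · linarith [FA_lip hA hm h]
  linarith

lemma FA_near {A : Set ℝ} (hA : A ⊆ Icc (0 : ℝ) 1) (hm : MeasurableSet A) {x y ε : ℝ} (hε : 0 ≤ ε)
    (h : x ≤ y + ε) : FA A x ≤ FA A y + ε := by
  rcases le_total x y with h' | h'
  · linarith [FA_mono hA hm h']
  · linarith [FA_lip hA hm h']

lemma cor1 {A : Set ℝ} (hA : A ⊆ Icc (0 : ℝ) 1) (hm : MeasurableSet A)
    (hsf : ∀ x ∈ A, ∀ y ∈ A, ∀ z ∈ A, x + y ≠ 3 * z) {x0 x1 y0 y1 : ℝ} (h0 : x0 ∈ closure A)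
    (h1 : x1 ∈ closure A) (hx : x0 < x1) (hF : FA A y0 < FA A y1)
    (hD : y1 - y0 ≤ x1 - x0) :
    (FA A y1 - FA A y0) + min (x1 - x0) (FA A x1 - FA A x0 + (FA A y1 - FA A y0)) +
      3 * (FA A ((x1 + y1) / 3) - FA A ((x0 + y0) / 3)) ≤ x1 + y1 - x0 - y0 := by
  refine eps_lim (η := min ((x1 - x0) / 2) ((FA A y1 - FA A y0) / 2))
    (lt_min (by linarith) (by linarith)) fun ε hε hlt => ?_
  rw [lt_min_iff] at hlt
  obtain ⟨a, ha, hda⟩ := Metric.mem_closure_iff.1 h0 ε hε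
  obtain ⟨b, hb, hdb⟩ := Metric.mem_closure_iff.1 h1 ε hε
  rw [Real.dist_eq, abs_lt] at hda hdb
  have hab : a < b := by linarith
  have hy1 : FA A y1 ≤ FA A (y1 - 2 * ε) + 2 * ε := FA_near hA hm (by linarith) (by linarith)
  have hy' : y0 ≤ y1 - 2 * ε := by
    by_contra hc
    push Not at hc
    have := FA_mono hA hm hc.le
    linarith
  have fin : volume.real (A ∩ Icc y0 (y1 - 2 * ε)) = _ := FA_sub hA hm hy'
  have hn : (A ∩ Icc y0 (y1 - 2 * ε)).Nonempty := by
    rw [Set.nonempty_iff_ne_empty]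
    intro he
    rw [he] at fin
    simp at fin
    linarith
  have c := core hA hm hsf (X := A ∩ Icc a b) (Y := A ∩ Icc y0 (y1 - 2 * ε)) (N := ∅)
    inter_subset_left inter_subset_left (hm.inter measurableSet_Icc) (hm.inter measurableSet_Icc)
    (x0 := a) (x1 := b) (y0 := y0) (l := a + y0) (r := b + (y1 - 2 * ε))
    ⟨ha, by simp [hab.le]⟩ ⟨hb, by simp [hab.le]⟩ inter_subset_right
    (inter_subset_right.trans (Icc_subset_Icc le_rfl (by linarith))) hn hab (by simp) (by linarith)
    (by
      rintro x ⟨-, hx⟩ y ⟨-, hy⟩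
      right
      exact ⟨by linarith [hx.1, hy.1], by linarith [hx.2, hy.2]⟩)
  rw [fin, FA_sub hA hm hab.le] at c
  have n1 : FA A x1 ≤ FA A b + ε := FA_near hA hm hε.le (by linarith)
  have n2 : FA A a ≤ FA A x0 + ε := FA_near hA hm hε.le (by linarith)
  have n3 : FA A ((x1 + y1) / 3) ≤ FA A ((b + (y1 - 2 * ε)) / 3) + ε := FA_near hA hm hε.le (by linarith)
  have n4 : FA A ((a + y0) / 3) ≤ FA A ((x0 + y0) / 3) + ε := FA_near hA hm hε.le (by linarith)
  have := min_lip (a := x1 - x0) (b := FA A x1 - FA A x0 + (FA A y1 - FA A y0)) (a' := b - a)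
    (b' := FA A b - FA A a + (FA A (y1 - 2 * ε) - FA A y0)) (e := 4 * ε) (by linarith) (by linarith)
  linarith

lemma cor2 {A : Set ℝ} (hA : A ⊆ Icc (0 : ℝ) 1) (hm : MeasurableSet A)
    (hsf : ∀ x ∈ A, ∀ y ∈ A, ∀ z ∈ A, x + y ≠ 3 * z) {t e : ℝ} (ht : t ∈ closure A)
    (h1 : 1 ∈ closure A) (hte : t ≤ e) (he : e < 1) :
    (FA A 1 - FA A e) + min (1 - t) (2 * (FA A 1 - FA A e)) +
      3 * (FA A (2 / 3) - FA A ((t + e) / 3)) ≤ 2 - t - e := by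
  refine eps_lim (η := (1 - e) / 2) (by linarith) fun ε hε hlt => ?_
  obtain ⟨a, ha, hda⟩ := Metric.mem_closure_iff.1 ht ε hε
  obtain ⟨b, hb, hdb⟩ := Metric.mem_closure_iff.1 h1 ε hε
  rw [Real.dist_eq, abs_lt] at hda hdb
  have hb1 := (hA hb).2
  obtain ⟨f, hf⟩ : ∃ f, f = max e a := ⟨_, rfl⟩
  have hfe : e ≤ f := hf ▸ le_max_left _ _
  have hfa : a ≤ f := hf ▸ le_max_right _ _
  have hf2 : f ≤ e + ε := hf ▸ max_le (by linarith) (by linarith)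
  have hfb : f < b := by linarith
  have hmX : MeasurableSet ({a} ∪ (A ∩ Icc f b)) := (measurableSet_singleton a).union (hm.inter measurableSet_Icc)
  have hXA : ({a} ∪ (A ∩ Icc f b)) ⊆ A := union_subset (by simpa using ha) inter_subset_left
  have hXI : ({a} ∪ (A ∩ Icc f b)) ⊆ Icc a b := union_subset (by simpa using by linarith)
    (inter_subset_right.trans (Icc_subset_Icc hfa le_rfl))
  have c := core hA hm hsf (X := {a} ∪ (A ∩ Icc f b)) (Y := {a} ∪ (A ∩ Icc f b)) (N := {2 * a})
    hXA hXA hmX hmX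
    (x0 := a) (x1 := b) (y0 := a) (l := a + f) (r := 2 * b)
    (by simp) (Or.inr ⟨hb, by simp [hfb.le]⟩) hXI (by simpa using hXI) ⟨a, by simp⟩
    (by linarith) (by simp) (by linarith)
    (by
      rintro x (hx | ⟨-, hx⟩) y (hy | ⟨-, hy⟩)
      · left
        rw [mem_singleton_iff] at hx hy ⊢
        linarith
      · right
        rw [mem_singleton_iff] at hx
        exact ⟨by linarith [hy.1], by linarith [hy.2]⟩
      · right
        rw [mem_singleton_iff] at hy
        exact ⟨by linarith [hx.1], by linarith [hx.2]⟩
      · right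
        exact ⟨by linarith [hx.1, hy.1], by linarith [hx.2, hy.2]⟩)
  have vX : FA A b - FA A f ≤ volume.real ({a} ∪ (A ∩ Icc f b)) := by
    rw [← FA_sub hA hm hfb.le]
    exact measureReal_mono subset_union_right ((measure_mono hXI).trans_lt measure_Icc_lt_top).ne
  have n1 : FA A 1 ≤ FA A b + ε := FA_near hA hm hε.le (by linarith)
  have n2 : FA A f ≤ FA A e + ε := FA_near hA hm hε.le (by linarith)
  have n3 : FA A (2 / 3) ≤ FA A (2 * b / 3) + ε := FA_near hA hm hε.le (by linarith)
  have n4 : FA A ((a + f) / 3) ≤ FA A ((t + e) / 3) + ε := FA_near hA hm hε.le (by linarith)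
  have := min_lip (a := 1 - t) (b := 2 * (FA A 1 - FA A e)) (a' := b - a)
    (b' := volume.real ({a} ∪ (A ∩ Icc f b)) + volume.real ({a} ∪ (A ∩ Icc f b))) (e := 4 * ε)
    (by linarith) (by linarith)
  linarith

lemma first_pt {A : Set ℝ} (hA : A ⊆ Icc (0 : ℝ) 1) (hm : MeasurableSet A) {x y : ℝ} (h : x ≤ y) :
    FA A y = FA A x ∨ ∃ z ∈ closure A, x ≤ z ∧ z ≤ y ∧ FA A z = FA A x := by
  rcases (A ∩ Icc x y).eq_empty_or_nonempty with he | hn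
  · left
    apply FA_eq_of_empty hA hm h
    exact subset_eq_empty (inter_subset_inter_right _ Ioo_subset_Icc_self) he
  · right
    have hb : BddBelow (A ∩ Icc x y) := ⟨x, fun z hz => hz.2.1⟩
    have h1 : x ≤ sInf (A ∩ Icc x y) := le_csInf hn fun z hz => hz.2.1
    obtain ⟨w, hw⟩ := hn
    have h2 : sInf (A ∩ Icc x y) ≤ y := (csInf_le hb hw).trans hw.2.2
    refine ⟨sInf (A ∩ Icc x y), closure_mono inter_subset_left (csInf_mem_closure ⟨w, hw⟩ hb), h1, h2, ?_⟩
    apply FA_eq_of_empty hA hm h1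
    rw [Set.eq_empty_iff_forall_notMem]
    rintro z ⟨hz, hz1, hz2⟩
    exact absurd (csInf_le hb ⟨hz, hz1.le, hz2.le.trans h2⟩) (not_le.2 hz2)

lemma last_pt {A : Set ℝ} (hA : A ⊆ Icc (0 : ℝ) 1) (hm : MeasurableSet A) {x y : ℝ} (h : x ≤ y) :
    FA A y = FA A x ∨ ∃ z ∈ closure A, x ≤ z ∧ z ≤ y ∧ FA A y = FA A z := by
  rcases (A ∩ Icc x y).eq_empty_or_nonempty with he | hn
  · left
    apply FA_eq_of_empty hA hm h
    exact subset_eq_empty (inter_subset_inter_right _ Ioo_subset_Icc_self) he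
  · right
    have hb : BddAbove (A ∩ Icc x y) := ⟨y, fun z hz => hz.2.2⟩
    have h1 : sSup (A ∩ Icc x y) ≤ y := csSup_le hn fun z hz => hz.2.2
    obtain ⟨w, hw⟩ := hn
    have h2 : x ≤ sSup (A ∩ Icc x y) := hw.2.1.trans (le_csSup hb hw)
    refine ⟨sSup (A ∩ Icc x y), closure_mono inter_subset_left (csSup_mem_closure ⟨w, hw⟩ hb), h2, h1, ?_⟩
    apply FA_eq_of_empty hA hm h1
    rw [Set.eq_empty_iff_forall_notMem]
    rintro z ⟨hz, hz1, hz2⟩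
    exact absurd (le_csSup hb ⟨hz, h2.trans hz1.le, hz2.le⟩) (not_le.2 hz1)

lemma main_real {A : Set ℝ} (hA : A ⊆ Icc (0 : ℝ) 1) (hm : MeasurableSet A)
    (hsf : ∀ x ∈ A, ∀ y ∈ A, ∀ z ∈ A, x + y ≠ 3 * z) {a : ℝ} (ha : a ∈ closure A)
    (h1 : 1 ∈ closure A) (ha0 : 0 ≤ a) (hFa : FA A a = 0) (hpos : ∀ x, 0 ≤ FA A x)
    (hF1 : 5 / 12 ≤ FA A 1) : FA A 1 - FA A (a / 3 + 2 / 9) ≤ 1 / 3 := by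
  have near : ∀ x y ε : ℝ, 0 ≤ ε → x ≤ y + ε → FA A x ≤ FA A y + ε :=
    fun x y ε h1 h2 => FA_near hA hm h1 h2
  have mono : ∀ x y : ℝ, x ≤ y → FA A x ≤ FA A y := fun x y h => FA_mono hA hm h
  have ha1 : a < 1 := by
    by_contra hc
    have := mono 1 a (by linarith)
    linarith
  have c0 := cor2 hA hm hsf ha h1 le_rfl ha1
  have f0 := mono ((a + a) / 3) a (by linarith)
  have hs0 : FA A 1 ≤ FA A (2 / 3) + 1 / 3 := near _ _ _ (by norm_num) (by norm_num)
  have hs : 1 / 6 ≤ FA A 1 - FA A (2 / 3) ∧ a ≤ 1 / 3 := by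
    rcases le_total (1 - a) (2 * (FA A 1 - FA A a)) with h | h
    · rw [min_eq_left h] at c0
      constructor <;> linarith
    · rw [min_eq_right h] at c0
      constructor <;> linarith
  obtain ⟨hs, ha3⟩ := hs
  rcases first_pt hA hm (x := 2 / 3) (y := 1) (by norm_num) with h | ⟨e, he, he2, he1, hFe⟩
  · linarith
  have hse : FA A 1 ≤ FA A e + (1 - e) := near _ _ _ (by linarith) (by linarith)
  have he1' : e < 1 := by linarith
  have ss := cor2 hA hm hsf he h1 le_rfl he1'
  rw [min_eq_left (by linarith)] at ss
  have ss' : (e + e) / 3 = 2 * e / 3 := by ring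
  rw [ss'] at ss
  have aw := window hA hm hsf ha he1
  have ac : FA A ((a + e) / 3) ≤ FA A (a / 3 + 2 / 9) + (e - 2 / 3) / 3 :=
    near _ _ _ (by linarith) (by linarith)
  rcases first_pt hA hm (x := (a + 1) / 3) (y := 2 / 3) (by linarith) with h | ⟨z, hz, hz2, hz1, hFz⟩
  · linarith
  have zw := window hA hm hsf hz he1
  have zl : FA A ((z + e) / 3) ≤ FA A z + (e - 2 / 3) / 3 :=
    near _ _ _ (by linarith) (by linarith)
  have z4 := mono (4 / 9) ((z + 1) / 3) (by linarith)
  by_cases hI : 3 * (e - 2 / 3) ≤ 2 * a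
  · have q1 : FA A ((z + e) / 3) ≤ FA A z := mono _ _ (by linarith)
    have q2 : FA A (2 * e / 3) ≤ FA A (4 / 9) + 2 * (e - 2 / 3) / 3 :=
      near _ _ _ (by linarith) (by linarith)
    linarith
  by_cases hII : 1 / 3 - (FA A 1 - FA A (2 / 3)) ≤ 1 / 18
  · obtain ⟨τ, hτ⟩ : ∃ τ, τ = 1 - 2 * (FA A 1 - FA A (2 / 3)) := ⟨_, rfl⟩
    have τ4 := mono τ (4 / 9) (by linarith)
    rcases first_pt hA hm (x := τ) (y := 2 / 3) (by linarith) with h | ⟨t, ht, ht2, ht1, hFt⟩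
    · linarith
    have c := cor2 hA hm hsf ht h1 (ht1.trans he2) he1'
    rw [min_eq_left (by linarith)] at c
    have q1 : FA A ((t + e) / 3) ≤ FA A t := mono _ _ (by linarith)
    linarith
  · push Not at hI hII
    rcases last_pt hA hm (x := a) (y := 2 * e / 3) (by linarith) with h | ⟨x, hx, hx2, hx1, hFx⟩
    · have := hpos (a / 3 + 2 / 9)
      linarith
    by_cases hx4 : x ≤ 4 / 9
    · have := mono _ _ hx4
      linarith
    push Not at hx4
    have c := cor1 hA hm hsf ha hx (by linarith) (y0 := e) (y1 := 1) (by linarith) (by linarith)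
    have q : FA A x ≤ FA A ((x + 1) / 3) ∨
        FA A x ≤ FA A ((x + 1) / 3) + (2 * x - 1) / 3 ∧ 1 ≤ 2 * x := by
      rcases le_total (2 * x) 1 with h | h
      · left; exact mono _ _ (by linarith)
      · right; exact ⟨near _ _ _ (by linarith) (by linarith), h⟩
    rcases le_total (x - a) (FA A x - FA A a + (FA A 1 - FA A e)) with h | h
    · rw [min_eq_left h] at c
      rcases q with q | ⟨q, q'⟩ <;> linarith
    · rw [min_eq_right h] at c
      rcases q with q | ⟨q, q'⟩ <;> linarith


end

/-- If `A` is a measurable 3-sum-free subset of `[0,1]` with `sup A = 1` and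
`μ(A) ≥ 5/12`, then `μ(A ∩ [(inf A)/3 + 2/9, 1]) ≤ 1/3`. -/
theorem measure_inter_le_third (A : Set ℝ)
    (hA : A ⊆ Icc (0 : ℝ) 1) (hmeas : MeasurableSet A) (hsup : sSup A = 1)
    (hsf : ∀ x ∈ A, ∀ y ∈ A, ∀ z ∈ A, x + y ≠ 3 * z)
    (hμ : 5 / 12 ≤ volume A) :
    volume (A ∩ Icc (sInf A / 3 + 2/9 : ℝ) 1) ≤ 1 / 3 := by
  have fA : volume A ≠ ⊤ := ((measure_mono hA).trans_lt measure_Icc_lt_top).ne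
  have hne : A.Nonempty := by
    rw [Set.nonempty_iff_ne_empty]
    rintro rfl
    simp at hsup
  have hbb : BddBelow A := ⟨0, fun z hz => (hA hz).1⟩
  have hba : BddAbove A := ⟨1, fun z hz => (hA hz).2⟩
  have ha := csInf_mem_closure hne hbb
  have h1 := csSup_mem_closure hne hba
  rw [hsup] at h1
  have ha0 : 0 ≤ sInf A := le_csInf hne fun z hz => (hA hz).1
  have ha1 : sInf A ≤ 1 := by
    obtain ⟨z, hz⟩ := hne
    exact (csInf_le hbb hz).trans (hA hz).2
  have hpos : ∀ x, 0 ≤ FA A x := fun x => measureReal_nonneg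
  have hFa : FA A (sInf A) = 0 := by
    have e1 : FA A (sInf A) = FA A (-1) := by
      apply FA_eq_of_empty hA hmeas (by linarith)
      rw [Set.eq_empty_iff_forall_notMem]
      rintro z ⟨hz, hz1, hz2⟩
      exact absurd (csInf_le hbb hz) (not_le.2 hz2)
    have e2 : A ∩ Iic (-1) = ∅ := by
      rw [Set.eq_empty_iff_forall_notMem]
      rintro z ⟨hz, hz1⟩
      have := (hA hz).1
      have : z ≤ -1 := hz1
      linarith
    rw [e1]
    unfold FA
    rw [e2]
    simp
  have hF1 : 5 / 12 ≤ FA A 1 := by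
    have e : A ∩ Iic 1 = A := inter_eq_left.2 fun z hz => (hA hz).2
    unfold FA
    rw [e]
    have := ENNReal.toReal_mono fA hμ
    rw [ENNReal.toReal_div] at this
    simpa [Measure.real] using this
  have key := main_real hA hmeas hsf ha h1 ha0 hFa hpos hF1
  rw [← FA_sub hA hmeas (by linarith)] at key
  have fin : volume (A ∩ Icc (sInf A / 3 + 2/9 : ℝ) 1) ≠ ⊤ :=
    ((measure_mono inter_subset_left).trans_lt fA.lt_top).ne
  rw [← ENNReal.toReal_le_toReal fin (by simp), ENNReal.toReal_div]
  simpa [Measure.real] using key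
end

section
/- Let X, Y ⊆ ℝ and let α < β and γ < δ be real numbers such that X ⊆ (α, β) with inner Lebesgue measure μ_*(X) = β − α, and Y ⊆ (γ, δ) with μ_*(Y) = δ − γ. Then the Minkowski sumset satisfies X + Y = (α + γ, β + δ). -/
open MeasureTheory Set
open scoped Pointwise

/-- The inner Lebesgue measure of a set of reals: the supremum of the measures of
compact subsets. -/
noncomputable def innerMeasure (S : Set ℝ) : ENNReal :=
  ⨆ (K : Set ℝ) (_ : IsCompact K) (_ : K ⊆ S), volume K

theorem null_of_full (X : Set ℝ) (α β : ℝ) (hαβ : α < β)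
    (hX : X ⊆ Ioo α β) (hXfull : innerMeasure X = ENNReal.ofReal (β - α)) :
    volume (Ioo α β \ X) = 0 := by
  by_contra hc
  have hv : volume (Ioo α β) = ENNReal.ofReal (β - α) := Real.volume_Ioo
  have hfin : volume (Ioo α β \ X) ≠ ⊤ :=
    ((measure_mono sdiff_subset).trans_lt (by rw [hv]; exact ENNReal.ofReal_lt_top)).ne
  have h1 : innerMeasure X ≤ volume (Ioo α β) - volume (Ioo α β \ X) := by
    unfold innerMeasure
    refine iSup_le fun K => iSup_le fun hK => iSup_le fun hKX => ?_
    refine ENNReal.le_sub_of_add_le_right hfin ?_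
    have h2 : volume (Ioo α β \ X) ≤ volume (Ioo α β \ K) :=
      measure_mono (sdiff_subset_sdiff_right hKX)
    calc volume K + volume (Ioo α β \ X) ≤ volume K + volume (Ioo α β \ K) := by gcongr
      _ = volume (Ioo α β ∩ K) + volume (Ioo α β \ K) := by
        rw [inter_eq_self_of_subset_right (hKX.trans hX)]
      _ = volume (Ioo α β) := measure_inter_add_sdiff _ hK.measurableSet
  rw [hXfull, hv] at h1
  have h3 : ENNReal.ofReal (β - α) ≠ 0 := by
    simpa using hαβ
  exact absurd h1 (not_le.mpr (ENNReal.sub_lt_self ENNReal.ofReal_ne_top h3 hc))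

/-- If `X ⊆ (α, β)` and `Y ⊆ (γ, δ)` are of full inner measure in these intervals,
then `X + Y = (α + γ, β + δ)`. -/
theorem add_eq_Ioo_of_full_innerMeasure (X Y : Set ℝ) (α β γ δ : ℝ)
    (hαβ : α < β) (hγδ : γ < δ)
    (hX : X ⊆ Ioo α β) (hXfull : innerMeasure X = ENNReal.ofReal (β - α))
    (hY : Y ⊆ Ioo γ δ) (hYfull : innerMeasure Y = ENNReal.ofReal (δ - γ)) :
    X + Y = Ioo (α + γ) (β + δ) := by
  apply Subset.antisymm
  · rintro _ ⟨x, hx, y, hy, rfl⟩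
    exact ⟨add_lt_add (hX hx).1 (hY hy).1, add_lt_add (hX hx).2 (hY hy).2⟩
  · rintro z ⟨hz1, hz2⟩
    have nX := null_of_full X α β hαβ hX hXfull
    have nY := null_of_full Y γ δ hγδ hY hYfull
    have nY2 : volume ((fun x => z - x) ⁻¹' (Ioo γ δ \ Y)) = 0 :=
      (Measure.measurePreserving_sub_left volume z).quasiMeasurePreserving.preimage_null nY
    by_contra hz
    have hsub : Ioo (max α (z - δ)) (min β (z - γ)) ⊆
        (Ioo α β \ X) ∪ ((fun x => z - x) ⁻¹' (Ioo γ δ \ Y)) := by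
      rintro x ⟨h1, h2⟩
      rw [max_lt_iff] at h1
      rw [lt_min_iff] at h2
      by_cases hx : x ∈ X
      · right
        refine ⟨⟨by linarith [h2.2], by linarith [h1.2]⟩, fun hy => hz ?_⟩
        exact ⟨x, hx, z - x, hy, by simp⟩
      · left
        exact ⟨⟨h1.1, h2.1⟩, hx⟩
    have h0 := measure_mono_null hsub (measure_union_null nX nY2)
    rw [Real.volume_Ioo, ENNReal.ofReal_eq_zero] at h0
    have : max α (z - δ) < min β (z - γ) := by
      rw [max_lt_iff, lt_min_iff, lt_min_iff]
      refine ⟨⟨?_, ?_⟩, ?_, ?_⟩ <;> linarith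
    linarith
end

section
/- Let A be a measurable 3-sum-free subset of [0,1] with sup A = 1. Set A₁ = A ∩ [2/3, 1], ε₁ = inf A₁ − 2/3 and ε₂ = (1/3 − ε₁) − μ(A₁), and assume ε₁ + 2ε₂ ≤ 1/3. Then μ(A ∩ [4/9 + (2/3)ε₁, 2/3]) ≤ ε₂/3. -/
open MeasureTheory Set

lemma aux_fin {S : Set ℝ} {p q : ℝ} (h : S ⊆ Icc p q) : volume S ≠ ⊤ :=
  ne_top_of_le_ne_top (by simp) (measure_mono h)

lemma aux_pack {P Q : Set ℝ} {p q : ℝ} (hpq : p ≤ q) (hP : P ⊆ Icc p q) (hQ : Q ⊆ Icc p q)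
    (hm : MeasurableSet Q) (h0 : volume (P ∩ Q) = 0) :
    volume.real P + volume.real Q ≤ q - p := by
  have h1 := measureReal_union_add_inter (μ := volume) (s := P) hm (aux_fin hP) (aux_fin hQ)
  have h2 : volume.real (P ∩ Q) = 0 := by simp [measureReal_def, h0]
  have h3 : volume.real (P ∪ Q) ≤ volume.real (Icc p q) :=
    measureReal_mono (union_subset hP hQ) (by simp)
  rw [Real.volume_real_Icc_of_le hpq] at h3
  linarith

lemma aux_reflect {B : Set ℝ} (hB : MeasurableSet B) {p q : ℝ} (hpq : p ≤ q)
    (h : ∀ x ∈ B, ∀ y ∈ B, x + y ≠ p + q) :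
    volume.real (B ∩ Icc p q) ≤ (q - p) / 2 := by
  have hm : MeasurableSet (B ∩ Icc p q) := hB.inter measurableSet_Icc
  have hmp := Measure.measurePreserving_sub_left (volume : Measure ℝ) (p + q)
  have h1 : volume.real ((fun t => (p + q) - t) ⁻¹' (B ∩ Icc p q)) =
      volume.real (B ∩ Icc p q) := by
    rw [measureReal_def, hmp.measure_preimage hm.nullMeasurableSet, measureReal_def]
  have h2 := aux_pack (P := (fun t => (p + q) - t) ⁻¹' (B ∩ Icc p q)) (Q := B ∩ Icc p q) hpq
    (by
      rintro x ⟨_, hx1, hx2⟩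
      constructor <;> linarith) inter_subset_right hm (by
      convert measure_empty (μ := (volume : Measure ℝ))
      ext x
      simp only [mem_inter_iff, mem_preimage, mem_empty_iff_false, iff_false]
      rintro ⟨⟨hx, _⟩, hx', _⟩
      exact h _ hx _ hx' (by ring))
  linarith

lemma aux_null {T : Set ℝ} (hT : MeasurableSet T)
    (h : ∀ x ∈ T, ∀ y ∈ T, x ≤ y → volume.real (T ∩ Icc x y) ≤ (y - x) / 2) :
    volume T = 0 := by
  by_contra h0
  have : (ae (volume.restrict T)).NeBot := by
    rw [ae_neBot]
    simpa using h0
  obtain ⟨x, hxT, hx⟩ := ((ae_restrict_mem hT).and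
    (Besicovitch.ae_tendsto_measure_inter_div volume T)).exists
  have hev := hx.eventually (lt_mem_nhds (show ENNReal.ofReal (3/4) < 1 by
    rw [ENNReal.ofReal_lt_one]; norm_num))
  obtain ⟨r, hr, hr0⟩ := (hev.and self_mem_nhdsWithin).exists
  have hr0 : 0 < r := hr0
  have hmain : volume.real (T ∩ Metric.closedBall x r) ≤ r := by
    rw [Real.closedBall_eq_Icc]
    set S := T ∩ Icc (x - r) (x + r) with hS
    have hxS : x ∈ S := ⟨hxT, by constructor <;> linarith⟩
    have hbb : BddBelow S := ⟨x - r, fun y hy => hy.2.1⟩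
    have hba : BddAbove S := ⟨x + r, fun y hy => hy.2.2⟩
    apply le_of_forall_pos_le_add
    intro e he
    obtain ⟨s, hs, hs'⟩ := exists_lt_of_csInf_lt ⟨x, hxS⟩ (show sInf S < sInf S + e / 2 by linarith)
    obtain ⟨t, ht, ht'⟩ := exists_lt_of_lt_csSup ⟨x, hxS⟩ (show sSup S - e / 2 < sSup S by linarith)
    have hsub : S ⊆ (T ∩ Icc (min s t) (max s t)) ∪ (Icc (sInf S) (sInf S + e / 2) ∪
        Icc (sSup S - e / 2) (sSup S)) := by
      intro y hy
      have h1 := csInf_le hbb hy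
      have h2 := le_csSup hba hy
      by_cases h3 : y ≤ sInf S + e / 2
      · exact Or.inr (Or.inl ⟨h1, h3⟩)
      by_cases h4 : sSup S - e / 2 ≤ y
      · exact Or.inr (Or.inr ⟨h4, h2⟩)
      refine Or.inl ⟨hy.1, ?_, ?_⟩
      · exact (min_le_left _ _).trans (by linarith)
      · exact le_trans (by linarith) (le_max_right _ _)
    have hmin : min s t ∈ S := by rcases min_choice s t with h | h <;> rw [h] <;> assumption
    have hmax : max s t ∈ S := by rcases max_choice s t with h | h <;> rw [h] <;> assumption
    have h1 := h _ hmin.1 _ hmax.1 (min_le_max)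
    have h2 : volume.real S ≤ _ := measureReal_mono hsub (by
      refine measure_union_ne_top (aux_fin inter_subset_right) (measure_union_ne_top ?_ ?_) <;> simp)
    have h3 := measureReal_union_le (μ := volume) (T ∩ Icc (min s t) (max s t)) (Icc (sInf S) (sInf S + e / 2) ∪
        Icc (sSup S - e / 2) (sSup S))
    have h4 := measureReal_union_le (μ := volume) (Icc (sInf S) (sInf S + e / 2))
        (Icc (sSup S - e / 2) (sSup S))
    rw [Real.volume_real_Icc_of_le (by linarith), Real.volume_real_Icc_of_le (by linarith)] at h4
    have h5 := hmin.2.1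
    have h6 := hmax.2.2
    linarith
  rw [Real.volume_closedBall] at hr
  have hfin : volume (T ∩ Metric.closedBall x r) ≠ ⊤ := by
    rw [Real.closedBall_eq_Icc]; exact aux_fin inter_subset_right
  have h1 : volume (T ∩ Metric.closedBall x r) ≤ ENNReal.ofReal r := by
    rw [← ENNReal.ofReal_toReal hfin]
    exact ENNReal.ofReal_le_ofReal hmain
  have h2 := hr.trans_le (ENNReal.div_le_div_right h1 _)
  rw [← ENNReal.ofReal_div_of_pos (by linarith)] at h2
  have h3 := (ENNReal.ofReal_lt_ofReal_iff_of_nonneg (by norm_num)).1 h2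
  rw [lt_div_iff₀ (by linarith)] at h3
  linarith

/-- a consequence of Steinhaus -/
lemma aux_steinhaus {E B : Set ℝ} (hE : MeasurableSet E) (a : ℝ)
    (hcl : ∀ e > 0, ∃ u ∈ B, |u - a| < e)
    (h : ∀ x ∈ E, ∀ y ∈ E, ∀ u ∈ B, u - a ≠ x - y) : volume E = 0 := by
  by_contra h0
  have h1 := Measure.sub_mem_nhds_zero_of_addHaar_pos volume E hE (pos_iff_ne_zero.2 h0)
  obtain ⟨e, he, hsub⟩ := Metric.mem_nhds_iff.1 h1
  obtain ⟨u, hu, hua⟩ := hcl e he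
  obtain ⟨x, hx, y, hy, hxy⟩ := hsub (show u - a ∈ Metric.ball 0 e by simpa using hua)
  exact h x hx y hy u hu hxy.symm

lemma aux_main {B C : Set ℝ} {a : ℝ} (ha : a ≤ 1) (hB : MeasurableSet B) (hC : MeasurableSet C)
    (hBs : B ⊆ Icc a 1) (hCs : C ⊆ Icc (2 * a) 2)
    (hBa : ∀ e > 0, ∃ u ∈ B, |u - a| < e) (hB1 : ∀ e > 0, ∃ u ∈ B, |u - 1| < e)
    (h : ∀ x ∈ B, ∀ y ∈ B, x + y ∉ C) (hc : 1 - a ≤ 2 * volume.real B) :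
    volume.real C ≤ 1 - a - volume.real B := by
  set C1 := Icc a 1 ∩ (fun x => x + a) ⁻¹' C with hC1
  set C2 := Icc a 1 ∩ (fun x => x + 1) ⁻¹' C with hC2
  have m1 : MeasurableSet C1 := measurableSet_Icc.inter (by measurability)
  have m2 : MeasurableSet C2 := measurableSet_Icc.inter (by measurability)
  have s1 : C1 ⊆ Icc a 1 := inter_subset_left
  have s2 : C2 ⊆ Icc a 1 := inter_subset_left
  have n1 : volume (C1 ∩ B) = 0 := by
    refine aux_steinhaus (m1.inter hB) a hBa ?_
    rintro x ⟨⟨_, hx⟩, _⟩ y ⟨_, hy⟩ u hu hh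
    apply h u hu y hy
    have : u + y = x + a := by linarith
    rw [this]; exact hx
  have n2 : volume (C2 ∩ B) = 0 := by
    refine aux_steinhaus (m2.inter hB) 1 hB1 ?_
    rintro x ⟨⟨_, hx⟩, _⟩ y ⟨_, hy⟩ u hu hh
    apply h u hu y hy
    have : u + y = x + 1 := by linarith
    rw [this]; exact hx
  have hU : volume.real (C1 ∪ C2) + volume.real B ≤ 1 - a := by
    refine aux_pack ha (union_subset s1 s2) hBs hB ?_
    rw [union_inter_distrib_right]
    exact measure_union_null n1 n2
  -- the value of the distribution function on the intersection
  have hF : ∀ x ∈ C1 ∩ C2, volume.real (B ∩ Icc a x) ≤ (x - a) / 2 ∧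
      (x - a) / 2 ≤ volume.real (B ∩ Icc a x) := by
    rintro x ⟨⟨hx, hxa⟩, ⟨_, hx1⟩⟩
    have e1 := aux_reflect hB hx.1 (fun y hy z hz hyz => h y hy z hz (by
      rw [hyz, add_comm]; exact hxa))
    have e2 := aux_reflect hB hx.2 (fun y hy z hz hyz => h y hy z hz (by
      rw [hyz]; exact hx1))
    refine ⟨e1, ?_⟩
    have e3 : volume.real B ≤ volume.real (B ∩ Icc a x ∪ B ∩ Icc x 1) := by
      refine measureReal_mono ?_ (measure_union_ne_top (aux_fin inter_subset_right)
        (aux_fin inter_subset_right))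
      intro y hy
      rcases le_total y x with hyx | hyx
      · exact Or.inl ⟨hy, (hBs hy).1, hyx⟩
      · exact Or.inr ⟨hy, hyx, (hBs hy).2⟩
    have e4 := measureReal_union_le (μ := volume) (B ∩ Icc a x) (B ∩ Icc x 1)
    linarith
  have hT : volume (C1 ∩ C2) = 0 := by
    refine aux_null (m1.inter m2) ?_
    intro x hx y hy hxy
    have e1 := (hF x hx).1
    have e2 := (hF y hy).2
    have e3 : volume.real (B ∩ Icc a y) ≤ volume.real (B ∩ Icc a x ∪ B ∩ Icc x y) := by
      refine measureReal_mono ?_ (measure_union_ne_top (aux_fin inter_subset_right)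
        (aux_fin inter_subset_right))
      rintro z ⟨hz, hz1, hz2⟩
      rcases le_total z x with hzx | hzx
      · exact Or.inl ⟨hz, hz1, hzx⟩
      · exact Or.inr ⟨hz, hzx, hz2⟩
    have e4 := measureReal_union_le (μ := volume) (B ∩ Icc a x) (B ∩ Icc x y)
    have e5 := aux_pack (P := C1 ∩ C2 ∩ Icc x y) (Q := B ∩ Icc x y) hxy inter_subset_right
      inter_subset_right (hB.inter measurableSet_Icc)
      (measure_mono_null (show C1 ∩ C2 ∩ Icc x y ∩ (B ∩ Icc x y) ⊆ C1 ∩ B from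
        fun z hz => ⟨hz.1.1.1, hz.2.1⟩) n1)
    linarith
  have hsum := measureReal_union_add_inter (μ := volume) (s := C1) m2 (aux_fin s1) (aux_fin s2)
  have hT' : volume.real (C1 ∩ C2) = 0 := by simp [measureReal_def, hT]
  have v1 : volume ((fun x => x + -a) ⁻¹' C1) = volume C1 := measure_preimage_add_right _ _ _
  have v2 : volume ((fun x => x + -1) ⁻¹' C2) = volume C2 := measure_preimage_add_right _ _ _
  have hcov : volume.real C ≤
      volume.real ((fun x => x + -a) ⁻¹' C1 ∪ (fun x => x + -1) ⁻¹' C2) := by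
    refine measureReal_mono ?_ (measure_union_ne_top (by rw [v1]; exact aux_fin s1)
      (by rw [v2]; exact aux_fin s2))
    intro c hc
    have hcc := hCs hc
    rcases le_total c (1 + a) with h1 | h1
    · refine Or.inl ⟨⟨by linarith [hcc.1], by linarith⟩, ?_⟩
      simpa using hc
    · refine Or.inr ⟨⟨by linarith, by linarith [hcc.2]⟩, ?_⟩
      simpa using hc
  have hle := measureReal_union_le (μ := volume) ((fun x => x + -a) ⁻¹' C1)
    ((fun x => x + -1) ⁻¹' C2)
  simp only [measureReal_def, v1, v2] at *
  linarith

/-- Let `A` be a measurable 3-sum-free subset of `[0,1]` with `sup A = 1`,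
`A₁ = A ∩ [2/3,1]`, `ε₁ = inf A₁ − 2/3`, `ε₂ = (1/3 − ε₁) − μ(A₁)`, and assume
`ε₁ + 2ε₂ ≤ 1/3`. Then `μ(A ∩ [4/9 + 2ε₁/3, 2/3]) ≤ ε₂/3`. -/
theorem measure_A_two_thirds_le (A : Set ℝ)
    (hA : A ⊆ Icc (0 : ℝ) 1) (hmeas : MeasurableSet A) (hsup : sSup A = 1)
    (hsf : ∀ x ∈ A, ∀ y ∈ A, ∀ z ∈ A, x + y ≠ 3 * z)
    (ε₁ ε₂ : ℝ)
    (hε₁ : ε₁ = sInf (A ∩ Icc (2/3 : ℝ) 1) - 2/3)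
    (hε₂ : ε₂ = (1/3 - ε₁) - (volume (A ∩ Icc (2/3 : ℝ) 1)).toReal)
    (hcond : ε₁ + 2 * ε₂ ≤ 1/3) :
    (volume (A ∩ Icc (4/9 + 2/3 * ε₁ : ℝ) (2/3))).toReal ≤ ε₂ / 3 := by
  have hne : A.Nonempty := by
    by_contra hh
    rw [not_nonempty_iff_eq_empty] at hh
    simp [hh] at hsup
  set B := A ∩ Icc (2/3 : ℝ) 1 with hBdef
  have hB1 : ∀ e > 0, ∃ u ∈ B, |u - 1| < e := by
    intro e he
    obtain ⟨u, hu, hu'⟩ := exists_lt_of_lt_csSup hne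
      (show max (1 - e) (2/3) < sSup A by rw [hsup]; exact max_lt (by linarith) (by norm_num))
    have h1 := (le_max_left _ _).trans_lt hu'
    have h2 := (le_max_right _ _).trans_lt hu'
    have h3 := (hA hu).2
    refine ⟨u, ⟨hu, h2.le, h3⟩, ?_⟩
    rw [abs_lt]; constructor <;> linarith
  have hBne : B.Nonempty := by
    obtain ⟨u, hu, _⟩ := hB1 1 one_pos
    exact ⟨u, hu⟩
  have hbb : BddBelow B := ⟨2/3, fun y hy => hy.2.1⟩
  set a := sInf B with ha
  have hBa : ∀ e > 0, ∃ u ∈ B, |u - a| < e := by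
    intro e he
    obtain ⟨u, hu, hu'⟩ := exists_lt_of_csInf_lt hBne (show sInf B < a + e by linarith)
    have := csInf_le hbb hu
    refine ⟨u, hu, ?_⟩
    rw [abs_lt]; constructor <;> linarith
  have hBs : B ⊆ Icc a 1 := fun y hy => ⟨csInf_le hbb hy, hy.2.2⟩
  have ha1 : a ≤ 1 := by
    obtain ⟨u, hu⟩ := hBne
    exact (hBs hu).1.trans (hBs hu).2
  set D := A ∩ Icc (4/9 + 2/3 * ε₁ : ℝ) (2/3) with hD
  have hDm : MeasurableSet D := hmeas.inter measurableSet_Icc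
  have hCm : MeasurableSet ((fun x : ℝ => (1/3) * x) ⁻¹' D) :=
    (measurable_const_mul (1/3 : ℝ)) hDm
  have key := aux_main (B := B) (C := (fun x : ℝ => (1/3) * x) ⁻¹' D) ha1
    (hmeas.inter measurableSet_Icc) hCm hBs
    (by
      rintro x ⟨_, h1, h2⟩
      constructor <;> linarith) hBa hB1
    (by
      rintro x hx y hy ⟨hz, _⟩
      exact hsf x hx.1 y hy.1 _ hz (by ring))
    (by rw [measureReal_def]; linarith)
  rw [measureReal_def, measureReal_def, Real.volume_preimage_mul_left (by norm_num),
    ENNReal.toReal_mul, ENNReal.toReal_ofReal (abs_nonneg _)] at key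
  norm_num at key
  linarith
end

section
/- Let A be a measurable 3-sum-free subset of [0,1] with sup A = 1. Set A₁ = A ∩ [2/3, 1], ε₁ = inf A₁ − 2/3 and ε₂ = (1/3 − ε₁) − μ(A₁), and assume ε₁ + 2ε₂ ≤ 1/3. Then μ(A ∩ [1/3 + ε₁/2, 4/9 + ε₁/6]) ≤ ε₂/3. -/
open MeasureTheory Set

/-- Let `A` be a measurable 3-sum-free subset of `[0,1]` with `sup A = 1`,
`A₁ = A ∩ [2/3,1]`, `ε₁ = inf A₁ − 2/3`, `ε₂ = (1/3 − ε₁) − μ(A₁)`, and assume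
`ε₁ + 2ε₂ ≤ 1/3`. Then `μ(A ∩ [1/3 + ε₁/2, 4/9 + ε₁/6]) ≤ ε₂/3`. -/
theorem measure_A_four_ninths_le (A : Set ℝ)
    (hA : A ⊆ Icc (0 : ℝ) 1) (hmeas : MeasurableSet A) (hsup : sSup A = 1)
    (hsf : ∀ x ∈ A, ∀ y ∈ A, ∀ z ∈ A, x + y ≠ 3 * z)
    (ε₁ ε₂ : ℝ)
    (hε₁ : ε₁ = sInf (A ∩ Icc (2/3 : ℝ) 1) - 2/3)
    (hε₂ : ε₂ = (1/3 - ε₁) - (volume (A ∩ Icc (2/3 : ℝ) 1)).toReal)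
    (hcond : ε₁ + 2 * ε₂ ≤ 1/3) :
    (volume (A ∩ Icc (1/3 + ε₁/2 : ℝ) (4/9 + ε₁/6))).toReal ≤ ε₂ / 3 := by
  set A₁ := A ∩ Icc (2/3 : ℝ) 1 with hA₁
  have hA₁m : MeasurableSet A₁ := hmeas.inter measurableSet_Icc
  have hbdd : BddBelow A₁ := ⟨2/3, fun x hx => hx.2.1⟩
  have hAne : A.Nonempty := by
    by_contra h
    rw [not_nonempty_iff_eq_empty] at h
    rw [h, Real.sSup_empty] at hsup
    norm_num at hsup
  have hne : A₁.Nonempty := by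
    obtain ⟨x, hx, hlt⟩ := exists_lt_of_lt_csSup hAne (show (2/3 : ℝ) < sSup A by rw [hsup]; norm_num)
    exact ⟨x, hx, hlt.le, (hA hx).2⟩
  have hsub : A₁ ⊆ Icc (2/3 + ε₁) 1 := fun x hx =>
    ⟨by have := csInf_le hbdd hx; linarith, hx.2.2⟩
  have hL : 2/3 + ε₁ ≤ 1 := by
    obtain ⟨x, hx⟩ := hne
    exact (hsub hx).1.trans (hsub hx).2
  -- any measurable subset of the interval disjoint from A₁ has small measure
  have key : ∀ C : Set ℝ, C ⊆ Icc (2/3 + ε₁) 1 → Disjoint A₁ C → MeasurableSet C →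
      volume.real C ≤ ε₂ := by
    intro C hC hd hCm
    have h1 : volume.real (A₁ ∪ C) ≤ volume.real (Icc (2/3 + ε₁) 1) :=
      measureReal_mono (union_subset hsub hC) (by simp)
    have f1 : volume A₁ ≠ ⊤ := measure_ne_top_of_subset hsub (by simp)
    have f2 : volume C ≠ ⊤ := measure_ne_top_of_subset hC (by simp)
    rw [measureReal_union hd hCm f1 f2, Real.volume_real_Icc_of_le hL] at h1
    have : (volume A₁).toReal = volume.real A₁ := rfl
    linarith
  have hε₂0 : 0 ≤ ε₂ := by simpa using key ∅ (by simp) (by simp) MeasurableSet.empty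
  set B := A ∩ Icc (1/3 + ε₁/2 : ℝ) (4/9 + ε₁/6) with hB
  have hBm : MeasurableSet B := hmeas.inter measurableSet_Icc
  change volume.real B ≤ ε₂ / 3
  have hBf : volume B ≠ ⊤ := measure_ne_top_of_subset inter_subset_right (by simp)
  rcases B.eq_empty_or_nonempty with h0 | hBne
  · rw [h0]; simp; linarith
  have hBbdd : BddBelow B := ⟨1/3 + ε₁/2, fun x hx => hx.2.1⟩
  have step : ∀ w ∈ B, volume.real (B ∩ Ici w) ≤ ε₂ / 3 := by
    intro w hw
    set D := B ∩ Ici w with hD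
    have hDm : MeasurableSet D := hBm.inter measurableSet_Ici
    let C : Set ℝ := (fun x => x + w) ⁻¹' ((fun x => (1/3 : ℝ) * x) ⁻¹' D)
    have hCm : MeasurableSet C := by
      apply measurableSet_preimage (by fun_prop)
      exact measurableSet_preimage (by fun_prop) hDm
    have hv : volume.real C = 3 * volume.real D := by
      simp only [C, Measure.real]
      rw [measure_preimage_add_right, Real.volume_preimage_mul_left (by norm_num), ENNReal.toReal_mul]
      norm_num
    have h := key C ?_ ?_ hCm
    · linarith
    · rintro x ⟨⟨h1, h2, h3⟩, h4⟩
      have h4' : w ≤ 1/3 * (x + w) := h4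
      obtain ⟨h5, h6, h7⟩ := hw
      constructor <;> simp only at * <;> linarith
    · rw [disjoint_left]
      rintro x hx ⟨⟨h1, _⟩, _⟩
      exact hsf x hx.1 w hw.1 _ h1 (by ring)
  refine le_of_forall_pos_le_add fun δ hδ => ?_
  obtain ⟨w, hw, hwl⟩ := exists_lt_of_csInf_lt hBne (show sInf B < sInf B + δ by linarith)
  have hcov : B ⊆ (B ∩ Ici w) ∪ Icc (sInf B) (sInf B + δ) := by
    intro x hx
    rcases le_total w x with h | h
    · exact Or.inl ⟨hx, h⟩
    · exact Or.inr ⟨csInf_le hBbdd hx, h.trans hwl.le⟩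
  have h1 : volume.real B ≤ volume.real ((B ∩ Ici w) ∪ Icc (sInf B) (sInf B + δ)) :=
    measureReal_mono hcov (measure_union_ne_top
      (measure_ne_top_of_subset inter_subset_left hBf) (by simp))
  have h2 := measureReal_union_le (μ := volume) (B ∩ Ici w) (Icc (sInf B) (sInf B + δ))
  rw [Real.volume_real_Icc_of_le (by linarith)] at h2
  have := step w hw
  linarith
end

section
/- Let A be a measurable 3-sum-free subset of [0,1] with sup A = 1. Set a = inf A, A₁ = A ∩ [2/3, 1], ε₁ = inf A₁ − 2/3 and ε₂ = (1/3 − ε₁) − μ(A₁), and assume ε₁ + 2ε₂ ≤ 1/3. Then μ(A ∩ [2/9 + (a + ε₁)/3, 1/3 + a/3]) ≤ ε₂/3. -/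
open MeasureTheory Set

/-- Let `A` be a measurable 3-sum-free subset of `[0,1]` with `sup A = 1`,
`a = inf A`, `A₁ = A ∩ [2/3,1]`, `ε₁ = inf A₁ − 2/3`, `ε₂ = (1/3 − ε₁) − μ(A₁)`, and
assume `ε₁ + 2ε₂ ≤ 1/3`. Then `μ(A ∩ [2/9 + (a+ε₁)/3, 1/3 + a/3]) ≤ ε₂/3`. -/
theorem measure_A_one_third_le (A : Set ℝ)
    (hA : A ⊆ Icc (0 : ℝ) 1) (hmeas : MeasurableSet A) (hsup : sSup A = 1)
    (hsf : ∀ x ∈ A, ∀ y ∈ A, ∀ z ∈ A, x + y ≠ 3 * z)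
    (a ε₁ ε₂ : ℝ) (ha : a = sInf A)
    (hε₁ : ε₁ = sInf (A ∩ Icc (2/3 : ℝ) 1) - 2/3)
    (hε₂ : ε₂ = (1/3 - ε₁) - (volume (A ∩ Icc (2/3 : ℝ) 1)).toReal)
    (hcond : ε₁ + 2 * ε₂ ≤ 1/3) :
    (volume (A ∩ Icc (2/9 + (a + ε₁)/3 : ℝ) (1/3 + a/3))).toReal ≤ ε₂ / 3 := by
  have hne : A.Nonempty := by
    by_contra h
    rw [not_nonempty_iff_eq_empty] at h
    simp [h] at hsup
  have hbdd : BddBelow A := ⟨0, fun x hx => (hA hx).1⟩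
  set A₁ := A ∩ Icc (2/3 : ℝ) 1 with hA₁
  set b := sInf A₁ with hb
  have hbdd1 : BddBelow A₁ := ⟨2/3, fun x hx => hx.2.1⟩
  have hne1 : A₁.Nonempty := by
    obtain ⟨x, hx, hlt⟩ := exists_lt_of_lt_csSup hne (b := 2/3) (by rw [hsup]; norm_num)
    exact ⟨x, hx, hlt.le, (hA hx).2⟩
  have hb23 : 2/3 ≤ b := le_csInf hne1 fun x hx => hx.2.1
  have hb1 : b ≤ 1 := by
    obtain ⟨x, hx⟩ := hne1
    exact (csInf_le hbdd1 hx).trans hx.2.2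
  have hsub1 : A₁ ⊆ Icc b 1 := fun x hx => ⟨csInf_le hbdd1 hx, hx.2.2⟩
  have hm1 : MeasurableSet A₁ := hmeas.inter measurableSet_Icc
  have hcompl : volume.real (Icc b 1 \ A₁) = ε₂ := by
    rw [measureReal_sdiff hsub1 hm1 (by exact isCompact_Icc.measure_lt_top.ne), Real.volume_real_Icc_of_le hb1, hε₂, hε₁, measureReal_def]
    ring
  refine le_of_forall_pos_le_add fun δ hδ => ?_
  obtain ⟨x, hxA, hxlt⟩ := exists_lt_of_csInf_lt hne (b := a + δ) (by linarith)
  have hax : a ≤ x := ha ▸ csInf_le hbdd hxA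
  set S := A ∩ Icc (2/9 + (a + ε₁)/3 : ℝ) (1/3 + a/3) with hS
  set T := Icc (b - δ) b ∪ (Icc b 1 \ A₁) with hT
  have hTfin : volume T ≠ ⊤ := by
    refine ((measure_mono (t := Icc (b-δ) 1) ?_).trans_lt isCompact_Icc.measure_lt_top).ne
    rintro y (⟨h1, h2⟩ | ⟨⟨h1, h2⟩, -⟩) <;> constructor <;> linarith
  have hST : S ⊆ (fun z => 3 * z) ⁻¹' ((fun y => y + -x) ⁻¹' T) := by
    rintro z ⟨hz, hz1, hz2⟩
    simp only [mem_preimage]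
    by_cases h : 3 * z + -x ≤ b
    · left
      constructor <;> linarith
    · right
      refine ⟨⟨by linarith, by linarith⟩, fun h' => ?_⟩
      exact hsf x hxA _ h'.1 z hz (by ring)
  have hvol : volume ((fun z : ℝ => 3 * z) ⁻¹' ((fun y => y + -x) ⁻¹' T))
      = ENNReal.ofReal (1/3) * volume T := by
    rw [Real.volume_preimage_mul_left (by norm_num), measure_preimage_add_right]
    norm_num
  have h1 : (volume S).toReal ≤ (ENNReal.ofReal (1/3) * volume T).toReal := by
    rw [← hvol]
    refine ENNReal.toReal_mono ?_ (measure_mono hST)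
    rw [hvol]
    exact ENNReal.mul_ne_top (by simp) hTfin
  have h2 : volume.real T ≤ δ + ε₂ := by
    refine (measureReal_union_le _ _).trans ?_
    rw [hcompl, Real.volume_real_Icc_of_le (by linarith)]
    linarith
  rw [ENNReal.toReal_mul, ENNReal.toReal_ofReal (by norm_num)] at h1
  rw [measureReal_def] at h2
  linarith
end

section
/- Let A be a measurable 3-sum-free subset of [0,1] with sup A = 1. Set a = inf A, A₁ = A ∩ [2/3, 1] and ε₁ = inf A₁ − 2/3, and assume ε₁ > (2/3)a. Then μ(A ∩ [1/3 + a/3, 1/3 + ε₁/2]) ≤ (3/4)·(ε₁/2 − a/3). -/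
open MeasureTheory Set

lemma aux_step (C : Set ℝ) (hC : MeasurableSet C) (h3 : ∀ x ∈ C, 3 * x ∉ C) (t : ℝ) (ht : 0 ≤ t) :
    volume.real (C ∩ Ioc 0 t) ≤ volume.real (C ∩ Ioc 0 (t/9)) + 2/3 * t := by
  have fin : ∀ u v : ℝ, volume (C ∩ Ioc u v) ≠ ⊤ := fun u v =>
    ((measure_mono inter_subset_right).trans_lt measure_Ioc_lt_top).ne
  have hsub : C ∩ Ioc 0 t ⊆ (C ∩ Ioc 0 (t/9)) ∪ ((C ∩ Ioc (t/9) (t/3)) ∪ (C ∩ Ioc (t/3) t)) := by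
    rintro x ⟨hx, h0, h1⟩
    rcases le_or_gt x (t/9) with h | h
    · exact Or.inl ⟨hx, h0, h⟩
    · rcases le_or_gt x (t/3) with h' | h'
      · exact Or.inr (Or.inl ⟨hx, h, h'⟩)
      · exact Or.inr (Or.inr ⟨hx, h', h1⟩)
  have e1 : volume.real (C ∩ Ioc 0 t) ≤ volume.real (C ∩ Ioc 0 (t/9)) +
      (volume.real (C ∩ Ioc (t/9) (t/3)) + volume.real (C ∩ Ioc (t/3) t)) := by
    refine (measureReal_mono hsub ?_).trans ((measureReal_union_le _ _).trans ?_)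
    · exact (measure_union_lt_top (fin _ _).lt_top
        (measure_union_lt_top (fin _ _).lt_top (fin _ _).lt_top)).ne
    · gcongr
      exact measureReal_union_le _ _
  set D := (fun x : ℝ => (3:ℝ)⁻¹ * x) ⁻¹' (C ∩ Ioc (t/9) (t/3)) with hD
  have hDv : volume.real D = 3 * volume.real (C ∩ Ioc (t/9) (t/3)) := by
    rw [hD, measureReal_def, Real.volume_preimage_mul_left (by norm_num), ENNReal.toReal_mul]
    rw [ENNReal.toReal_ofReal (by positivity), measureReal_def]
    norm_num
  have hDsub : D ⊆ Ioc (t/3) t := by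
    rintro x ⟨_, h1, h2⟩
    constructor <;> linarith
  have hdisj : Disjoint D (C ∩ Ioc (t/3) t) := by
    rw [Set.disjoint_left]
    rintro x ⟨hx, _⟩ ⟨hx', _⟩
    apply h3 _ hx
    convert hx' using 1
    ring
  have e2 : volume.real D + volume.real (C ∩ Ioc (t/3) t) ≤ 2/3 * t := by
    rw [← measureReal_union hdisj (hC.inter measurableSet_Ioc)
      ((measure_mono hDsub).trans_lt measure_Ioc_lt_top).ne (fin _ _)]
    refine (measureReal_mono (union_subset hDsub inter_subset_right) measure_Ioc_lt_top.ne).trans ?_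
    rw [Real.volume_real_Ioc_of_le (by linarith)]
    linarith
  have : 0 ≤ volume.real (C ∩ Ioc (t/9) (t/3)) := measureReal_nonneg
  linarith

lemma aux_iter (C : Set ℝ) (hC : MeasurableSet C) (h3 : ∀ x ∈ C, 3 * x ∉ C) (n : ℕ) :
    ∀ t : ℝ, 0 ≤ t → volume.real (C ∩ Ioc 0 t) ≤ 3/4 * t + t * (1/9)^n := by
  induction n with
  | zero =>
    intro t ht
    refine (measureReal_mono inter_subset_right measure_Ioc_lt_top.ne).trans ?_
    rw [Real.volume_real_Ioc_of_le ht]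
    norm_num
    linarith
  | succ n ih =>
    intro t ht
    have h1 := aux_step C hC h3 t ht
    have h2 := ih (t/9) (by linarith)
    rw [pow_succ]
    linarith

lemma aux_main_s19 (C : Set ℝ) (hC : MeasurableSet C) (h3 : ∀ x ∈ C, 3 * x ∉ C) (t : ℝ) (ht : 0 ≤ t) :
    volume.real (C ∩ Ioc 0 t) ≤ 3/4 * t := by
  have hl : Filter.Tendsto (fun n : ℕ => 3/4 * t + t * (1/9:ℝ)^n) Filter.atTop
      (nhds (3/4 * t + t * 0)) :=
    ((tendsto_pow_atTop_nhds_zero_of_lt_one (by norm_num) (by norm_num)).const_mul t).const_add _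
  have := ge_of_tendsto' hl (fun n => aux_iter C hC h3 n t ht)
  linarith

/-- Let `A` be a measurable 3-sum-free subset of `[0,1]` with `sup A = 1`,
`a = inf A`, `A₁ = A ∩ [2/3,1]`, `ε₁ = inf A₁ − 2/3`, and assume `ε₁ > 2a/3`.
Then `μ(A ∩ [1/3 + a/3, 1/3 + ε₁/2]) ≤ (3/4)(ε₁/2 − a/3)`. -/
theorem measure_B_one_third_le (A : Set ℝ)
    (hA : A ⊆ Icc (0 : ℝ) 1) (hmeas : MeasurableSet A) (hsup : sSup A = 1)
    (hsf : ∀ x ∈ A, ∀ y ∈ A, ∀ z ∈ A, x + y ≠ 3 * z)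
    (a ε₁ : ℝ) (ha : a = sInf A)
    (hε₁ : ε₁ = sInf (A ∩ Icc (2/3 : ℝ) 1) - 2/3)
    (hcond : ε₁ > 2/3 * a) :
    (volume (A ∩ Icc (1/3 + a/3 : ℝ) (1/3 + ε₁/2))).toReal
      ≤ (3/4) * (ε₁/2 - a/3) := by
  have hne : A.Nonempty := by
    rw [nonempty_iff_ne_empty]
    rintro rfl
    simp at hsup
  have hne1 : (A ∩ Icc (2/3 : ℝ) 1).Nonempty := by
    obtain ⟨x, hx, hx'⟩ := exists_lt_of_lt_csSup hne (show (2/3:ℝ) < sSup A by rw [hsup]; norm_num)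
    exact ⟨x, hx, hx'.le, (hA hx).2⟩
  have hbdd : BddBelow (A ∩ Icc (2/3 : ℝ) 1) := ⟨2/3, fun x hx => hx.2.1⟩
  apply le_of_forall_pos_le_add
  intro δ hδ
  obtain ⟨b, hb, hb'⟩ := exists_lt_of_csInf_lt hne1
    (show sInf (A ∩ Icc (2/3 : ℝ) 1) < sInf (A ∩ Icc (2/3 : ℝ) 1) + δ by linarith)
  have hb2 := csInf_le hbdd hb
  have hbA := hb.1
  have h3 : ∀ x ∈ (fun c : ℝ => b/2 - c) ⁻¹' A, 3 * x ∉ (fun c : ℝ => b/2 - c) ⁻¹' A := by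
    intro x hx hx3
    refine hsf _ hx3 _ hbA _ hx ?_
    ring
  have hC : MeasurableSet ((fun c : ℝ => b/2 - c) ⁻¹' A) := hmeas.preimage (by fun_prop)
  have key := aux_main_s19 _ hC h3 (b/2 - (1/3 + a/3)) (by linarith)
  have hpre : volume (A ∩ Icc (1/3 + a/3 : ℝ) (1/3 + ε₁/2)) =
      volume ((fun c : ℝ => b/2 - c) ⁻¹' (A ∩ Icc (1/3 + a/3 : ℝ) (1/3 + ε₁/2))) :=
    ((Measure.measurePreserving_sub_left volume (b/2)).measure_preimage
      (hmeas.inter measurableSet_Icc).nullMeasurableSet).symm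
  rw [hpre]
  have hmono : volume.real ((fun c : ℝ => b/2 - c) ⁻¹' (A ∩ Icc (1/3 + a/3 : ℝ) (1/3 + ε₁/2))) ≤
      volume.real ((fun c : ℝ => b/2 - c) ⁻¹' A ∩ Ioc 0 (b/2 - (1/3 + a/3))) := by
    refine measureReal_mono ?_ ((measure_mono inter_subset_right).trans_lt measure_Ioc_lt_top).ne
    rintro x ⟨hx, h1, h2⟩
    refine ⟨hx, ?_, by linarith⟩
    have h0 : 0 ≤ x := by linarith
    refine lt_of_le_of_ne h0 ?_
    rintro rfl
    exact h3 0 hx (by simpa using hx)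
  rw [measureReal_def] at hmono
  linarith
end
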